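/- arXiv:2108.05282 — 4 statements merged into one kernel-verified Lean document; each statement's English description precedes it below -/
import Mathlib

section
/- For every λ > 0 and every natural number n, the rescaled weighted counts of noncrossing monotone labeled partitions converge to the n-th moment of ν_λ: lim_{m→∞} m^{−n/2} · g_{m,n}(λ√m) = ∫_ℝ x^n dν_λ(x). -/
open MeasureTheory

-- `π` is a set partition of `{1, …, n}` (encoded on `Fin n`).
def IsSetPartition {n : ℕ} (π : Finset (Finset (Fin n))) : Prop :=
  (∀ B ∈ π, B.Nonempty) ∧ (∀ i : Fin n, ∃ B ∈ π, i ∈ B) ∧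
    (∀ B ∈ π, ∀ B' ∈ π, B ≠ B' → Disjoint B B')

-- `π` is noncrossing.
def NonCrossing {n : ℕ} (π : Finset (Finset (Fin n))) : Prop :=
  ∀ B ∈ π, ∀ B' ∈ π, B ≠ B' →
    ∀ v₁ ∈ B, ∀ v₂ ∈ B, ∀ w₁ ∈ B', ∀ w₂ ∈ B',
      ¬(v₁ < w₁ ∧ w₁ < v₂ ∧ v₂ < w₂)

-- `B'` is nested (non-strictly) inside `B`: `min B ≤ min B' ≤ max B' ≤ max B`.
def NestedLE {n : ℕ} (B B' : Finset (Fin n)) : Prop :=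
  ∃ lo ∈ B, ∃ hi ∈ B, ∀ x ∈ B', lo ≤ x ∧ x ≤ hi

-- `B'` is strictly nested inside `B`: `min B < min B'` and `max B' < max B`.
def NestedLT {n : ℕ} (B B' : Finset (Fin n)) : Prop :=
  ∃ lo ∈ B, ∃ hi ∈ B, ∀ x ∈ B', lo < x ∧ x < hi

-- the block `B` strictly encloses the point `w`.
def StrictEnc {n : ℕ} (B : Finset (Fin n)) (w : Fin n) : Prop :=
  ∃ v₁ ∈ B, ∃ v₂ ∈ B, v₁ < w ∧ w < v₂

-- the unlabeled part of `ANC^{wm}(m, n)`: a noncrossing partition of `{1, …, n}`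
-- with all blocks of cardinality `1` or `2`, every singleton block being inner
-- (strictly enclosed by some two-element block).
def IsANCPart {n : ℕ} (π : Finset (Finset (Fin n))) : Prop :=
  IsSetPartition π ∧ NonCrossing π ∧ (∀ B ∈ π, B.card ≤ 2) ∧
    (∀ B ∈ π, B.card = 1 → ∀ w ∈ B, ∃ B' ∈ π, B'.card = 2 ∧ StrictEnc B' w)

-- the label function `L : π → {1, …, m}` is weakly monotone for the nesting order,
-- and every singleton block carries the same label as the innermost two-element
-- block strictly enclosing it.
def WMLabel {n m : ℕ} (π : Finset (Finset (Fin n))) (L : {B // B ∈ π} → Fin m) : Prop :=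
  (∀ B B' : {B // B ∈ π}, NestedLE B.val B'.val → L B ≤ L B') ∧
    (∀ S : {B // B ∈ π}, S.val.card = 1 → ∀ w ∈ S.val,
      ∃ B' : {B // B ∈ π}, B'.val.card = 2 ∧ StrictEnc B'.val w ∧
        (∀ B'' : {B // B ∈ π}, B''.val.card = 2 → StrictEnc B''.val w →
          NestedLE B''.val B'.val) ∧
        L S = L B')

-- in addition, `L` is monotone: strictly increasing along strictly nested
-- two-element blocks.
def MLabel {n m : ℕ} (π : Finset (Finset (Fin n))) (L : {B // B ∈ π} → Fin m) : Prop :=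
  WMLabel π L ∧
    ∀ B B' : {B // B ∈ π}, B.val.card = 2 → B'.val.card = 2 →
      NestedLT B.val B'.val → L B < L B'

-- `bWM m n lam = b_{m,n}(λ) = Σ_{ε ∈ ANC^{wm}(m,n)} λ^{|ε|_0}`.
open Classical in
noncomputable def bWM (m n : ℕ) (lam : ℝ) : ℝ :=
  ∑ π : Finset (Finset (Fin n)),
    if IsANCPart π then
      ∑ L : {B // B ∈ π} → Fin m,
        if WMLabel π L then lam ^ (π.filter fun B => B.card = 1).card else 0
    else 0

-- `gM m n lam = g_{m,n}(λ) = Σ_{ε ∈ ANC^{m}(m,n)} λ^{|ε|_0}`.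
open Classical in
noncomputable def gM (m n : ℕ) (lam : ℝ) : ℝ :=
  ∑ π : Finset (Finset (Fin n)),
    if IsANCPart π then
      ∑ L : {B // B ∈ π} → Fin m,
        if MLabel π L then lam ^ (π.filter fun B => B.card = 1).card else 0
    else 0

-- Absolutely continuous part of `ν_λ`.
open Classical in
noncomputable def nuAC (lam : ℝ) : Measure ℝ :=
  volume.withDensity fun x =>
    ENNReal.ofReal (if x ∈ Set.Ioo (lam - Real.sqrt 2) (lam + Real.sqrt 2) then
      Real.sqrt (2 - (x - lam) ^ 2) / (Real.pi * (lam ^ 2 + 2 - (x - lam) ^ 2)) else 0)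

-- `ν_λ = (λ/√(λ²+2))·δ_{λ−√(λ²+2)} + ν^{ac}_λ`.
noncomputable def nuMeas (lam : ℝ) : Measure ℝ :=
  (ENNReal.ofReal (lam / Real.sqrt (lam ^ 2 + 2))) •
      Measure.dirac (lam - Real.sqrt (lam ^ 2 + 2)) + nuAC lam

/-- Blocks are triples `(min, max, label)`; `p` is the label of the enclosing block, `0` if there
is none. -/
structure IsLabeledOn (m p a b : ℕ) (Λ : Finset (ℕ × ℕ × ℕ)) : Prop where
  bound : ∀ i j l, (i, j, l) ∈ Λ → a ≤ i ∧ i ≤ j ∧ j < b ∧ 1 ≤ l ∧ p ≤ l ∧ l ≤ m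
  cover : ∀ x, a ≤ x → x < b → ∃ i j l, (i, j, l) ∈ Λ ∧ (x = i ∨ x = j)
  disj : ∀ i j l i' j' l', (i, j, l) ∈ Λ → (i', j', l') ∈ Λ →
    (i = i' ∨ i = j' ∨ j = i' ∨ j = j') → i = i' ∧ j = j' ∧ l = l'
  noncrossing : ∀ i j l i' j' l', (i, j, l) ∈ Λ → (i', j', l') ∈ Λ → ¬(i < i' ∧ i' < j ∧ j < j')
  pair_label : ∀ i j l, (i, j, l) ∈ Λ → i < j → p < l
  mono : ∀ i j l i' j' l', (i, j, l) ∈ Λ → (i', j', l') ∈ Λ → i < i' → j' < j →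
    l ≤ l' ∧ (i' < j' → l < l')
  singleton_label : ∀ i l, (i, i, l) ∈ Λ →
    l = p ∨ ∃ i' j', (i', j', l) ∈ Λ ∧ i' < i ∧ i < j'

namespace IsLabeledOn

variable {m p a b j l : ℕ} {Λ I R : Finset (ℕ × ℕ × ℕ)}

theorem glue (hj : a ≤ j) (hjb : j < b) (hl : 1 ≤ l) (hlm : l ≤ m)
    (hok : (j = a ∧ l = p) ∨ (a < j ∧ p < l))
    (hI : IsLabeledOn m l (a + 1) j I) (hR : IsLabeledOn m p (j + 1) b R) :
    IsLabeledOn m p a b (insert (a, j, l) (I ∪ R)) := by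
  have bI := hI.bound
  have bR := hR.bound
  constructor
  · intro i j l h
    simp only [Finset.mem_insert, Finset.mem_union, Prod.mk.injEq] at h
    rcases h with h | h | h
    · omega
    · have := bI _ _ _ h; omega
    · have := bR _ _ _ h; omega
  · intro x hx hxb
    rcases lt_trichotomy x j with h | h | h
    · rcases hx.eq_or_lt with h' | h'
      · exact ⟨a, j, l, by simp, by omega⟩
      · obtain ⟨i, j, l, h1, h2⟩ := hI.cover x h' h
        exact ⟨i, j, l, by simp [h1], h2⟩
    · exact ⟨a, j, l, by simp, by omega⟩
    · obtain ⟨i, j, l, h1, h2⟩ := hR.cover x h hxb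
      exact ⟨i, j, l, by simp [h1], h2⟩
  · intro i j l i' j' l' h h' hs
    simp only [Finset.mem_insert, Finset.mem_union, Prod.mk.injEq] at h h'
    rcases h with h | h | h <;> rcases h' with h' | h' | h'
    · omega
    · have := bI _ _ _ h'; omega
    · have := bR _ _ _ h'; omega
    · have := bI _ _ _ h; omega
    · exact hI.disj _ _ _ _ _ _ h h' hs
    · have := bI _ _ _ h; have := bR _ _ _ h'; omega
    · have := bR _ _ _ h; omega
    · have := bR _ _ _ h; have := bI _ _ _ h'; omega
    · exact hR.disj _ _ _ _ _ _ h h' hs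
  · intro i j l i' j' l' h h' hs
    simp only [Finset.mem_insert, Finset.mem_union, Prod.mk.injEq] at h h'
    rcases h with h | h | h <;> rcases h' with h' | h' | h'
    · omega
    · have := bI _ _ _ h'; omega
    · have := bR _ _ _ h'; omega
    · have := bI _ _ _ h; omega
    · exact hI.noncrossing _ _ _ _ _ _ h h' hs
    · have := bI _ _ _ h; have := bR _ _ _ h'; omega
    · have := bR _ _ _ h; omega
    · have := bR _ _ _ h; have := bI _ _ _ h'; omega
    · exact hR.noncrossing _ _ _ _ _ _ h h' hs
  · intro i j l h hs
    simp only [Finset.mem_insert, Finset.mem_union, Prod.mk.injEq] at h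
    rcases h with h | h | h
    · omega
    · have := bI _ _ _ h; have := hI.pair_label _ _ _ h hs; omega
    · exact hR.pair_label _ _ _ h hs
  · intro i j l i' j' l' h h' hs hs'
    simp only [Finset.mem_insert, Finset.mem_union, Prod.mk.injEq] at h h'
    rcases h with h | h | h <;> rcases h' with h' | h' | h'
    · omega
    · have := bI _ _ _ h'; have := hI.pair_label _ _ _ h'; omega
    · have := bR _ _ _ h'; omega
    · have := bI _ _ _ h; omega
    · exact hI.mono _ _ _ _ _ _ h h' hs hs'
    · have := bI _ _ _ h; have := bR _ _ _ h'; omega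
    · have := bR _ _ _ h; omega
    · have := bR _ _ _ h; have := bI _ _ _ h'; omega
    · exact hR.mono _ _ _ _ _ _ h h' hs hs'
  · intro i k h
    simp only [Finset.mem_insert, Finset.mem_union, Prod.mk.injEq] at h
    rcases h with h | h | h
    · omega
    · have := bI _ _ _ h
      rcases hI.singleton_label _ _ h with h2 | ⟨i', j', h2, h3⟩
      · exact Or.inr ⟨a, j, by simp [h2], by omega⟩
      · exact Or.inr ⟨i', j', by simp [h2], h3⟩
    · rcases hR.singleton_label _ _ h with h2 | ⟨i', j', h2, h3⟩
      · exact Or.inl h2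
      · exact Or.inr ⟨i', j', by simp [h2], h3⟩

theorem first_label (h : IsLabeledOn m p a b Λ) (ha : (a, j, l) ∈ Λ) :
    (j = a ∧ l = p) ∨ (a < j ∧ p < l) := by
  have := h.bound _ _ _ ha
  rcases this.2.1.eq_or_lt with h' | h'
  · subst h'
    rcases h.singleton_label _ _ ha with h2 | ⟨i', j', h2, h3⟩
    · exact Or.inl ⟨rfl, h2⟩
    · have := h.bound _ _ _ h2; omega
  · exact Or.inr ⟨h', h.pair_label _ _ _ ha h'⟩

theorem trichotomy (h : IsLabeledOn m p a b Λ) (ha : (a, j, l) ∈ Λ) {i k c : ℕ}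
    (hi : (i, k, c) ∈ Λ) : (i = a ∧ k = j ∧ c = l) ∨ (a < i ∧ k < j) ∨ j < i := by
  have h1 := h.disj _ _ _ _ _ _ hi ha
  have h2 := h.noncrossing _ _ _ _ _ _ ha hi
  have h3 := h.bound _ _ _ hi
  have h4 := h.bound _ _ _ ha
  omega

theorem inner (h : IsLabeledOn m p a b Λ) (ha : (a, j, l) ∈ Λ) :
    IsLabeledOn m l (a + 1) j (Λ.filter fun t => a < t.1 ∧ t.2.1 < j) := by
  have hb := h.bound
  have hab := hb _ _ _ ha
  constructor
  · intro i k c hi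
    simp only [Finset.mem_filter] at hi
    have := hb _ _ _ hi.1
    have := h.mono _ _ _ _ _ _ ha hi.1 hi.2.1 hi.2.2
    omega
  · intro x hx hxj
    obtain ⟨i, k, c, h1, h2⟩ := h.cover x (by omega) (by omega)
    refine ⟨i, k, c, ?_, h2⟩
    have := h.trichotomy ha h1
    have := hb _ _ _ h1
    simp only [Finset.mem_filter, h1, true_and]
    omega
  · intro i j l i' j' l' h1 h2
    simp only [Finset.mem_filter] at h1 h2
    exact h.disj _ _ _ _ _ _ h1.1 h2.1
  · intro i j l i' j' l' h1 h2
    simp only [Finset.mem_filter] at h1 h2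
    exact h.noncrossing _ _ _ _ _ _ h1.1 h2.1
  · intro i k c h1 h2
    simp only [Finset.mem_filter] at h1
    exact (h.mono _ _ _ _ _ _ ha h1.1 h1.2.1 h1.2.2).2 h2
  · intro i j l i' j' l' h1 h2
    simp only [Finset.mem_filter] at h1 h2
    exact h.mono _ _ _ _ _ _ h1.1 h2.1
  · intro i c h1
    simp only [Finset.mem_filter] at h1
    have h5 := h.mono _ _ _ _ _ _ ha h1.1 h1.2.1 h1.2.2
    have h6 := h.pair_label _ _ _ ha
    rcases h.singleton_label _ _ h1.1 with h2 | ⟨i', j', h2, h3⟩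
    · omega
    · have := h.trichotomy ha h2
      by_cases hcl : c = l
      · exact Or.inl hcl
      · refine Or.inr ⟨i', j', ?_, h3⟩
        simp only [Finset.mem_filter, h2, true_and]
        omega

theorem outer (h : IsLabeledOn m p a b Λ) (ha : (a, j, l) ∈ Λ) :
    IsLabeledOn m p (j + 1) b (Λ.filter fun t => j < t.1) := by
  have hb := h.bound
  have hab := hb _ _ _ ha
  constructor
  · intro i k c hi
    simp only [Finset.mem_filter] at hi
    have := hb _ _ _ hi.1
    omega
  · intro x hx hxj
    obtain ⟨i, k, c, h1, h2⟩ := h.cover x (by omega) (by omega)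
    refine ⟨i, k, c, ?_, h2⟩
    have := h.trichotomy ha h1
    have := hb _ _ _ h1
    simp only [Finset.mem_filter, h1, true_and]
    omega
  · intro i j l i' j' l' h1 h2
    simp only [Finset.mem_filter] at h1 h2
    exact h.disj _ _ _ _ _ _ h1.1 h2.1
  · intro i j l i' j' l' h1 h2
    simp only [Finset.mem_filter] at h1 h2
    exact h.noncrossing _ _ _ _ _ _ h1.1 h2.1
  · intro i k c h1 h2
    simp only [Finset.mem_filter] at h1
    exact h.pair_label _ _ _ h1.1 h2
  · intro i j l i' j' l' h1 h2
    simp only [Finset.mem_filter] at h1 h2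
    exact h.mono _ _ _ _ _ _ h1.1 h2.1
  · intro i c h1
    simp only [Finset.mem_filter] at h1
    rcases h.singleton_label _ _ h1.1 with h2 | ⟨i', j', h2, h3⟩
    · exact Or.inl h2
    · have := h.trichotomy ha h2
      refine Or.inr ⟨i', j', ?_, h3⟩
      simp only [Finset.mem_filter, h2, true_and]
      omega

theorem eq_glue (h : IsLabeledOn m p a b Λ) (ha : (a, j, l) ∈ Λ) :
    insert (a, j, l) ((Λ.filter fun t => a < t.1 ∧ t.2.1 < j) ∪ Λ.filter fun t => j < t.1) = Λ := by
  ext ⟨i, k, c⟩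
  simp only [Finset.mem_insert, Finset.mem_union, Finset.mem_filter, Prod.mk.injEq]
  constructor
  · rintro (⟨rfl, rfl, rfl⟩ | h | h)
    exacts [ha, h.1, h.1]
  · intro hi
    have := h.trichotomy ha hi
    tauto

theorem inner_glue (hI : IsLabeledOn m l (a + 1) j I)
    (hR : IsLabeledOn m p (j + 1) b R) :
    (insert (a, j, l) (I ∪ R)).filter (fun t => a < t.1 ∧ t.2.1 < j) = I := by
  ext ⟨i, k, c⟩
  simp only [Finset.mem_insert, Finset.mem_union, Finset.mem_filter, Prod.mk.injEq]
  have := hI.bound i k c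
  have := hR.bound i k c
  grind

theorem outer_glue (hj : a ≤ j) (hI : IsLabeledOn m l (a + 1) j I)
    (hR : IsLabeledOn m p (j + 1) b R) :
    (insert (a, j, l) (I ∪ R)).filter (fun t => j < t.1) = R := by
  ext ⟨i, k, c⟩
  simp only [Finset.mem_insert, Finset.mem_union, Finset.mem_filter, Prod.mk.injEq]
  have := hI.bound i k c
  have := hR.bound i k c
  grind

end IsLabeledOn

open Classical in
noncomputable def labeledOn (m p a b : ℕ) : Finset (Finset (ℕ × ℕ × ℕ)) :=
  (Finset.range b ×ˢ Finset.range b ×ˢ Finset.range (m + 1)).powerset.filter fun Λ =>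
    IsLabeledOn m p a b Λ

theorem mem_labeledOn {m p a b : ℕ} {Λ : Finset (ℕ × ℕ × ℕ)} :
    Λ ∈ labeledOn m p a b ↔ IsLabeledOn m p a b Λ := by
  classical
  rw [labeledOn, Finset.mem_filter, and_iff_right_iff_imp]
  intro h
  rw [Finset.mem_powerset]
  rintro ⟨i, j, l⟩ hi
  have := h.bound _ _ _ hi
  simp only [Finset.mem_product, Finset.mem_range]
  omega

noncomputable def blockWeight (μ : ℝ) (Λ : Finset (ℕ × ℕ × ℕ)) : ℝ :=
  ∏ t ∈ Λ, if t.1 = t.2.1 then μ else 1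

theorem blockWeight_glue {m p a b j l : ℕ} {I R : Finset (ℕ × ℕ × ℕ)} (μ : ℝ) (hj : a ≤ j)
    (hI : IsLabeledOn m l (a + 1) j I) (hR : IsLabeledOn m p (j + 1) b R) :
    blockWeight μ (insert (a, j, l) (I ∪ R)) =
      (if a = j then μ else 1) * (blockWeight μ I * blockWeight μ R) := by
  unfold blockWeight
  rw [Finset.prod_insert, Finset.prod_union]
  · rw [Finset.disjoint_left]
    rintro ⟨i, k, c⟩ h1 h2
    have := hI.bound _ _ _ h1
    have := hR.bound _ _ _ h2
    omega
  · intro h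
    rw [Finset.mem_union] at h
    rcases h with h | h
    · have := hI.bound _ _ _ h; omega
    · have := hR.bound _ _ _ h; omega

noncomputable def labeledSum (μ : ℝ) (m p a b : ℕ) : ℝ :=
  ∑ Λ ∈ labeledOn m p a b, blockWeight μ Λ

theorem labeledSum_of_le (μ : ℝ) {m p a b : ℕ} (h : b ≤ a) : labeledSum μ m p a b = 1 := by
  have : labeledOn m p a b = {∅} := by
    ext Λ
    rw [mem_labeledOn, Finset.mem_singleton]
    constructor
    · intro hΛ
      rw [Finset.eq_empty_iff_forall_notMem]
      rintro ⟨i, j, l⟩ hi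
      have := hΛ.bound _ _ _ hi
      omega
    · rintro rfl
      constructor <;> simp
      omega
  simp [labeledSum, this, blockWeight]

theorem sum_first_block (μ : ℝ) {m p a b j l : ℕ} (hj : a ≤ j) (hjb : j < b) (hl : 1 ≤ l)
    (hlm : l ≤ m) :
    ∑ Λ ∈ labeledOn m p a b with (a, j, l) ∈ Λ, blockWeight μ Λ =
      if (j = a ∧ l = p) ∨ (a < j ∧ p < l) then
        (if a = j then μ else 1) * (labeledSum μ m l (a + 1) j * labeledSum μ m p (j + 1) b)
      else 0 := by
  by_cases hok : (j = a ∧ l = p) ∨ (a < j ∧ p < l)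
  · rw [if_pos hok, labeledSum, labeledSum, Finset.sum_mul_sum, ← Finset.sum_product', Finset.mul_sum]
    refine Finset.sum_bij'
      (fun Λ _ => (Λ.filter (fun t => a < t.1 ∧ t.2.1 < j), Λ.filter fun t => j < t.1))
      (fun IR _ => insert (a, j, l) (IR.1 ∪ IR.2)) ?_ ?_ ?_ ?_ ?_
    · intro Λ hΛ
      rw [Finset.mem_filter, mem_labeledOn] at hΛ
      rw [Finset.mem_product, mem_labeledOn, mem_labeledOn]
      exact ⟨hΛ.1.inner hΛ.2, hΛ.1.outer hΛ.2⟩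
    · rintro ⟨I, R⟩ h
      rw [Finset.mem_product, mem_labeledOn, mem_labeledOn] at h
      rw [Finset.mem_filter, mem_labeledOn]
      exact ⟨.glue hj hjb hl hlm hok h.1 h.2, by simp⟩
    · intro Λ hΛ
      rw [Finset.mem_filter, mem_labeledOn] at hΛ
      exact hΛ.1.eq_glue hΛ.2
    · rintro ⟨I, R⟩ h
      rw [Finset.mem_product, mem_labeledOn, mem_labeledOn] at h
      exact Prod.ext (IsLabeledOn.inner_glue h.1 h.2) (IsLabeledOn.outer_glue hj h.1 h.2)
    · intro Λ hΛ
      rw [Finset.mem_filter, mem_labeledOn] at hΛ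
      rw [← blockWeight_glue μ hj (hΛ.1.inner hΛ.2) (hΛ.1.outer hΛ.2), hΛ.1.eq_glue hΛ.2]
  · rw [if_neg hok]
    refine Finset.sum_eq_zero fun Λ hΛ => absurd ?_ hok
    rw [Finset.mem_filter, mem_labeledOn] at hΛ
    exact hΛ.1.first_label hΛ.2

theorem labeledSum_eq_sum_first_block (μ : ℝ) {m p a b : ℕ} (hab : a < b) :
    labeledSum μ m p a b = ∑ j ∈ Finset.Ico a b, ∑ l ∈ Finset.Icc 1 m,
      if (j = a ∧ l = p) ∨ (a < j ∧ p < l) then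
        (if a = j then μ else 1) * (labeledSum μ m l (a + 1) j * labeledSum μ m p (j + 1) b)
      else 0 := by
  rw [← Finset.sum_product', labeledSum]
  trans ∑ jl ∈ Finset.Ico a b ×ˢ Finset.Icc 1 m,
    ∑ Λ ∈ labeledOn m p a b with (a, jl.1, jl.2) ∈ Λ, blockWeight μ Λ
  · simp_rw [Finset.sum_filter]
    rw [Finset.sum_comm]
    refine Finset.sum_congr rfl fun Λ hΛ => ?_
    rw [mem_labeledOn] at hΛ
    obtain ⟨i, j, l, h1, h2⟩ := hΛ.cover a le_rfl hab
    have h3 := hΛ.bound _ _ _ h1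
    obtain rfl : i = a := by omega
    rw [Finset.sum_eq_single_of_mem (j, l), if_pos h1]
    · simp only [Finset.mem_product, Finset.mem_Ico, Finset.mem_Icc]; omega
    · rintro ⟨j', l'⟩ - hne
      rw [if_neg]
      intro h4
      obtain ⟨-, rfl, rfl⟩ := hΛ.disj _ _ _ _ _ _ h1 h4 (Or.inl rfl)
      exact hne rfl
  · refine Finset.sum_congr rfl fun jl h => ?_
    simp only [Finset.mem_product, Finset.mem_Ico, Finset.mem_Icc] at h
    exact sum_first_block μ h.1.1 h.1.2 h.2.1 h.2.2

open PowerSeries in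
theorem labeledSum_eq_coeff {μ : ℝ} {m : ℕ} {f : ℕ → PowerSeries ℝ}
    (hf : ∀ p ≤ m, f p = 1 + X * (C (if p = 0 then 0 else μ) * f p
      + X * ((∑ l ∈ Finset.Ioc p m, f l) * f p))) :
    ∀ n p a : ℕ, p ≤ m → labeledSum μ m p a (a + n) = coeff n (f p) := by
  intro n
  induction n using Nat.strong_induction_on with
  | _ n ih =>
  intro p a hp
  rcases n with _ | n
  · rw [labeledSum_of_le μ (by omega), hf p hp]
    simp
  · rw [labeledSum_eq_sum_first_block μ (by omega), Finset.sum_eq_sum_Ico_succ_bot (by omega),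
      hf p hp, map_add, coeff_succ_X_mul, map_add, coeff_C_mul]
    rw [coeff_one, if_neg n.succ_ne_zero, zero_add]
    congr 1
    · have : labeledSum μ m p (a + 1) (a + (n + 1)) = coeff n (f p) := by
        rw [← ih n (by omega) p (a + 1) hp]; congr 1; omega
      simp only [lt_self_iff_false, false_and, or_false, true_and, if_true,
        labeledSum_of_le μ (show a ≤ a + 1 by omega), one_mul, this]
      rw [Finset.sum_ite_eq']
      by_cases h0 : p = 0
      · simp [h0]
      · rw [if_pos (by rw [Finset.mem_Icc]; omega), if_neg h0]
    · rcases n with _ | n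
      · simp
      rw [coeff_succ_X_mul, Finset.sum_mul, map_sum, Finset.sum_comm]
      have hs : Finset.Ioc p m = (Finset.Icc 1 m).filter (p < ·) := by
        ext x; simp only [Finset.mem_Ioc, Finset.mem_filter, Finset.mem_Icc]; omega
      rw [hs, Finset.sum_filter]
      refine Finset.sum_congr rfl fun l hl => ?_
      rw [Finset.mem_Icc] at hl
      rw [coeff_mul, Finset.Nat.sum_antidiagonal_eq_sum_range_succ_mk]
      split_ifs with hpl
      · rw [Finset.sum_Ico_eq_sum_range, show a + (n + 1 + 1) - (a + 1) = n + 1 by omega]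
        refine Finset.sum_congr rfl fun k hk => ?_
        rw [Finset.mem_range] at hk
        rw [if_pos (by omega), if_neg (by omega), one_mul, ← ih k (by omega) l (a + 1) hl.2,
          ← ih (n - k) (by omega) p (a + 1 + k + 1) hp]
        congr 2
        omega
      · refine Finset.sum_eq_zero fun k hk => ?_
        rw [Finset.mem_Ico] at hk
        rw [if_neg (by omega)]

theorem Finset.pair_eq_pair_of_le {α : Type*} [LinearOrder α] {x y x' y' : α} (h : x ≤ y)
    (h' : x' ≤ y') (he : ({x, y} : Finset α) = {x', y'}) : x = x' ∧ y = y' := by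
  have h1 : x ∈ ({x', y'} : Finset α) := he ▸ by simp
  have h2 : y ∈ ({x', y'} : Finset α) := he ▸ by simp
  have h3 : x' ∈ ({x, y} : Finset α) := he ▸ by simp
  have h4 : y' ∈ ({x, y} : Finset α) := he ▸ by simp
  simp only [Finset.mem_insert, Finset.mem_singleton] at h1 h2 h3 h4
  grind

theorem Finset.exists_eq_pair_of_card_le_two {α : Type*} [LinearOrder α] {B : Finset α}
    (hne : B.Nonempty) (hc : B.card ≤ 2) : ∃ x y, x ≤ y ∧ B = {x, y} := by
  have := hne.card_pos
  obtain h | h : B.card = 1 ∨ B.card = 2 := by omega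
  · obtain ⟨x, rfl⟩ := Finset.card_eq_one.1 h
    exact ⟨x, x, le_rfl, by simp⟩
  · obtain ⟨x, y, -, rfl⟩ := Finset.card_eq_two.1 h
    rcases le_total x y with h | h
    exacts [⟨x, y, h, rfl⟩, ⟨y, x, h, Finset.pair_comm _ _⟩]

open Classical in
/-- The triples `(min B, max B, L B + 1)` of the blocks `B` of cardinality at most two. -/
noncomputable def blockTriples {m n : ℕ} (π : Finset (Finset (Fin n)))
    (L : {B // B ∈ π} → Fin m) : Finset (ℕ × ℕ × ℕ) :=
  (Finset.range n ×ˢ Finset.range n ×ˢ Finset.range (m + 1)).filter fun t =>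
    ∃ x y : Fin n, x ≤ y ∧ ∃ h : {x, y} ∈ π, t = (x.val, y.val, (L ⟨{x, y}, h⟩).val + 1)

theorem mem_blockTriples {m n : ℕ} {π : Finset (Finset (Fin n))}
    {L : {B // B ∈ π} → Fin m} {t : ℕ × ℕ × ℕ} : t ∈ blockTriples π L ↔
    ∃ x y : Fin n, x ≤ y ∧ ∃ h : {x, y} ∈ π, t = (x.val, y.val, (L ⟨{x, y}, h⟩).val + 1) := by
  classical
  rw [blockTriples, Finset.mem_filter, and_iff_right_iff_imp]
  rintro ⟨x, y, -, h, rfl⟩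
  have := (L ⟨{x, y}, h⟩).isLt
  simp only [Finset.mem_product, Finset.mem_range]
  omega

theorem mk_mem_blockTriples {m n : ℕ} {π : Finset (Finset (Fin n))}
    {L : {B // B ∈ π} → Fin m} {x y : Fin n} {l : ℕ} :
    (x.val, y.val, l) ∈ blockTriples π L ↔
      x ≤ y ∧ ∃ h : {x, y} ∈ π, (L ⟨{x, y}, h⟩).val + 1 = l := by
  rw [mem_blockTriples]
  constructor
  · rintro ⟨x', y', hle, h, he⟩
    simp only [Prod.mk.injEq, Fin.val_inj] at he
    obtain ⟨rfl, rfl, rfl⟩ := he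
    exact ⟨hle, h, rfl⟩
  · rintro ⟨hle, h, rfl⟩
    exact ⟨x, y, hle, h, rfl⟩

theorem StrictEnc.of_pair {n : ℕ} {x y w : Fin n} (hle : x ≤ y)
    (h : StrictEnc ({x, y} : Finset (Fin n)) w) : x < w ∧ w < y := by
  obtain ⟨v, hv, v', hv', h1, h2⟩ := h
  simp only [Finset.mem_insert, Finset.mem_singleton] at hv hv'
  grind

theorem NestedLE.of_pair {n : ℕ} {x y x' y' : Fin n} (hle : x ≤ y)
    (h : NestedLE ({x, y} : Finset (Fin n)) {x', y'}) : x ≤ x' ∧ y' ≤ y := by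
  obtain ⟨v, hv, v', hv', h1⟩ := h
  have h2 := h1 x' (by simp)
  have h3 := h1 y' (by simp)
  simp only [Finset.mem_insert, Finset.mem_singleton] at hv hv'
  grind

theorem NestedLT.of_pair {n : ℕ} {x y x' y' : Fin n} (hle : x ≤ y)
    (h : NestedLT ({x, y} : Finset (Fin n)) {x', y'}) : x < x' ∧ y' < y := by
  obtain ⟨v, hv, v', hv', h1⟩ := h
  have h2 := h1 x' (by simp)
  have h3 := h1 y' (by simp)
  simp only [Finset.mem_insert, Finset.mem_singleton] at hv hv'
  grind

theorem isLabeledOn_blockTriples {m n : ℕ} {π : Finset (Finset (Fin n))}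
    {L : {B // B ∈ π} → Fin m} (hπ : IsANCPart π) (hL : MLabel π L) :
    IsLabeledOn m 0 0 n (blockTriples π L) := by
  obtain ⟨⟨hne, hcov, hdisj⟩, hnc, hcard, -⟩ := hπ
  obtain ⟨⟨hmono, hsing⟩, hstrict⟩ := hL
  have heq : ∀ B ∈ π, ∀ B' ∈ π, ∀ z ∈ B, z ∈ B' → B = B' := fun B hB B' hB' z hz hz' =>
    by_contra fun h => Finset.disjoint_left.1 (hdisj B hB B' hB' h) hz hz'
  constructor
  · intro i j l ht
    obtain ⟨x, y, hle, h, he⟩ := mem_blockTriples.1 ht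
    have := (L ⟨{x, y}, h⟩).isLt
    simp only [Prod.mk.injEq] at he
    omega
  · intro z _ hz
    obtain ⟨B, hB, hzB⟩ := hcov ⟨z, hz⟩
    obtain ⟨x, y, hle, rfl⟩ := Finset.exists_eq_pair_of_card_le_two (hne B hB) (hcard B hB)
    refine ⟨x, y, _, mk_mem_blockTriples.2 ⟨hle, hB, rfl⟩, ?_⟩
    simpa [Fin.ext_iff] using hzB
  · intro i j l i' j' l' ht ht' hs
    obtain ⟨x, y, hle, h, he⟩ := mem_blockTriples.1 ht
    obtain ⟨x', y', hle', h', he'⟩ := mem_blockTriples.1 ht'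
    simp only [Prod.mk.injEq] at he he'
    obtain ⟨rfl, rfl, rfl⟩ := he
    obtain ⟨rfl, rfl, rfl⟩ := he'
    have : ({x, y} : Finset (Fin n)) = {x', y'} := by
      simp only [Fin.val_inj] at hs
      rcases hs with rfl | rfl | rfl | rfl
      exacts [heq _ h _ h' x (by simp) (by simp), heq _ h _ h' x (by simp) (by simp),
        heq _ h _ h' y (by simp) (by simp), heq _ h _ h' y (by simp) (by simp)]
    obtain ⟨rfl, rfl⟩ := Finset.pair_eq_pair_of_le hle hle' this
    exact ⟨rfl, rfl, rfl⟩
  · intro i j l i' j' l' ht ht' hs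
    obtain ⟨x, y, hle, h, he⟩ := mem_blockTriples.1 ht
    obtain ⟨x', y', hle', h', he'⟩ := mem_blockTriples.1 ht'
    simp only [Prod.mk.injEq] at he he'
    obtain ⟨rfl, rfl, -⟩ := he
    obtain ⟨rfl, rfl, -⟩ := he'
    refine hnc _ h _ h' (fun he => ?_) x (by simp) y (by simp) x' (by simp) y' (by simp) hs
    have := Finset.pair_eq_pair_of_le hle hle' he
    have := hs.1.ne
    simp_all
  · intro i j l ht _
    obtain ⟨x, y, hle, h, he⟩ := mem_blockTriples.1 ht
    simp only [Prod.mk.injEq] at he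
    omega
  · intro i j l i' j' l' ht ht' h1 h2
    obtain ⟨x, y, hle, h, he⟩ := mem_blockTriples.1 ht
    obtain ⟨x', y', hle', h', he'⟩ := mem_blockTriples.1 ht'
    simp only [Prod.mk.injEq] at he he'
    obtain ⟨rfl, rfl, rfl⟩ := he
    obtain ⟨rfl, rfl, rfl⟩ := he'
    have hxy : x < y := by omega
    constructor
    · have := hmono ⟨_, h⟩ ⟨_, h'⟩ ⟨x, by simp, y, by simp, by
        simp only [Finset.mem_insert, Finset.mem_singleton]; rintro _ (rfl | rfl) <;> omega⟩
      simpa using this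
    · intro h3
      have := hstrict ⟨_, h⟩ ⟨_, h'⟩ (Finset.card_pair hxy.ne)
        (Finset.card_pair (Fin.ne_of_val_ne h3.ne)) ⟨x, by simp, y, by simp, by
        simp only [Finset.mem_insert, Finset.mem_singleton]; rintro _ (rfl | rfl) <;> omega⟩
      simpa using this
  · intro i l ht
    obtain ⟨x, y, hle, h, he⟩ := mem_blockTriples.1 ht
    simp only [Prod.mk.injEq] at he
    obtain ⟨rfl, he, rfl⟩ := he
    obtain rfl := Fin.val_inj.1 he
    obtain ⟨⟨B, hB⟩, hc, henc, -, hl⟩ := hsing ⟨_, h⟩ (by simp) x (by simp)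
    obtain ⟨x', y', hle', rfl⟩ := Finset.exists_eq_pair_of_card_le_two (hne B hB) (hcard B hB)
    obtain ⟨h1, h2⟩ := henc.of_pair hle'
    exact Or.inr ⟨x', y', mk_mem_blockTriples.2 ⟨hle', hB, by rw [hl]⟩, h1, h2⟩

theorem exists_blockTriples_eq {m n : ℕ} {Λ : Finset (ℕ × ℕ × ℕ)} (hΛ : IsLabeledOn m 0 0 n Λ) :
    ∃ (π : Finset (Finset (Fin n))) (L : {B // B ∈ π} → Fin m),
      IsANCPart π ∧ MLabel π L ∧ blockTriples π L = Λ := by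
  classical
  let P (B : Finset (Fin n)) (x y : Fin n) (k : Fin m) : Prop :=
    x ≤ y ∧ (x.val, y.val, k.val + 1) ∈ Λ ∧ B = {x, y}
  let π : Finset (Finset (Fin n)) := Finset.univ.filter fun B => ∃ x y k, P B x y k
  have hmem : ∀ {B}, B ∈ π ↔ ∃ x y k, P B x y k := by simp [π]
  choose f g L hL using fun B : {B // B ∈ π} => hmem.1 B.2
  have hLP : ∀ B (hB : B ∈ π) x y k, P B x y k → L ⟨B, hB⟩ = k := by
    intro B hB x y k h
    obtain ⟨h1, h2, h3⟩ := hL ⟨B, hB⟩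
    obtain ⟨h1', h2', h3'⟩ := h
    obtain ⟨h4, h5⟩ := Finset.pair_eq_pair_of_le h1 h1' (h3.symm.trans h3')
    rw [h4, h5] at h2
    have := hΛ.disj _ _ _ _ _ _ h2 h2' (Or.inl rfl)
    omega
  have hlift : ∀ {i j l}, (i, j, l) ∈ Λ → ∃ x y : Fin n, ∃ k : Fin m,
      x.val = i ∧ y.val = j ∧ l = k.val + 1 ∧ P {x, y} x y k := by
    intro i j l h
    have := hΛ.bound _ _ _ h
    refine ⟨⟨i, by omega⟩, ⟨j, by omega⟩, ⟨l - 1, by omega⟩, rfl, rfl, ?_, ?_, ?_, rfl⟩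
    · change l = l - 1 + 1; omega
    · simpa [Fin.le_def] using this.2.1
    · simpa [Nat.sub_add_cancel this.2.2.2.1] using h
  have henclose : ∀ {x : Fin n} {k : Fin m}, (x.val, x.val, k.val + 1) ∈ Λ →
      ∃ x' y', x' < x ∧ x < y' ∧ P {x', y'} x' y' k := by
    intro x k h
    rcases hΛ.singleton_label _ _ h with h1 | ⟨i, j, h1, h2⟩
    · omega
    · obtain ⟨x', y', k', rfl, rfl, hk, hP⟩ := hlift h1
      obtain rfl : k = k' := by omega
      exact ⟨x', y', h2.1, h2.2, hP⟩
  have hpair : ∀ {x y : Fin n}, ({x, y} : Finset (Fin n)).card = 2 → x ≠ y := by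
    rintro x y h rfl
    simp at h
  refine ⟨π, L, ⟨⟨?_, ?_, ?_⟩, ?_, ?_, ?_⟩, ⟨⟨?_, ?_⟩, ?_⟩, ?_⟩
  · intro B hB
    obtain ⟨x, y, k, -, -, rfl⟩ := hmem.1 hB
    simp
  · intro z
    obtain ⟨i, j, l, h, hz⟩ := hΛ.cover z (by omega) z.isLt
    obtain ⟨x, y, k, rfl, rfl, -, hP⟩ := hlift h
    refine ⟨{x, y}, hmem.2 ⟨x, y, k, hP⟩, ?_⟩
    simpa [Fin.ext_iff] using hz
  · intro B hB B' hB' hne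
    obtain ⟨x, y, k, -, h, rfl⟩ := hmem.1 hB
    obtain ⟨x', y', k', -, h', rfl⟩ := hmem.1 hB'
    rw [Finset.disjoint_left]
    intro z hz hz'
    simp only [Finset.mem_insert, Finset.mem_singleton] at hz hz'
    have := hΛ.disj _ _ _ _ _ _ h h' (by simp only [Fin.val_inj]; grind)
    simp only [Fin.val_inj] at this
    exact hne (by rw [this.1, this.2.1])
  · intro B hB B' hB' hne v₁ hv₁ v₂ hv₂ w₁ hw₁ w₂ hw₂ hc
    obtain ⟨x, y, k, hle, h, rfl⟩ := hmem.1 hB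
    obtain ⟨x', y', k', hle', h', rfl⟩ := hmem.1 hB'
    simp only [Finset.mem_insert, Finset.mem_singleton] at hv₁ hv₂ hw₁ hw₂
    have := hΛ.noncrossing _ _ _ _ _ _ h h'
    simp only [Fin.val_fin_lt] at this
    grind
  · intro B hB
    obtain ⟨x, y, k, -, -, rfl⟩ := hmem.1 hB
    exact Finset.card_le_two
  · intro B hB hc w hw
    obtain ⟨x, y, k, -, h, rfl⟩ := hmem.1 hB
    obtain rfl : x = y := by
      by_contra hne
      rw [Finset.card_pair hne] at hc
      omega
    obtain rfl : w = x := by simpa using hw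
    obtain ⟨x', y', h1, h2, hP⟩ := henclose h
    exact ⟨_, hmem.2 ⟨x', y', k, hP⟩, Finset.card_pair (h1.trans h2).ne,
      x', by simp, y', by simp, h1, h2⟩
  · rintro ⟨B, hB⟩ ⟨B', hB'⟩ hnest
    obtain ⟨x, y, k, hP⟩ := hmem.1 hB
    obtain ⟨x', y', k', hP'⟩ := hmem.1 hB'
    rw [hLP _ _ _ _ _ hP, hLP _ _ _ _ _ hP']
    obtain ⟨hle, h, rfl⟩ := hP
    obtain ⟨hle', h', rfl⟩ := hP'
    obtain ⟨h1, h2⟩ := hnest.of_pair hle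
    by_cases hs : x = x' ∨ y' = y
    · have := hΛ.disj _ _ _ _ _ _ h h' (by simp only [Fin.val_inj]; grind)
      omega
    · push Not at hs
      have := hΛ.mono _ _ _ _ _ _ h h' (h1.lt_of_ne hs.1) (h2.lt_of_ne hs.2)
      omega
  · rintro ⟨B, hB⟩ hc w hw
    obtain ⟨x, y, k, hP⟩ := hmem.1 hB
    rw [hLP _ _ _ _ _ hP]
    obtain ⟨hle, h, rfl⟩ := hP
    obtain rfl : x = y := by
      by_contra hne
      rw [Finset.card_pair hne] at hc
      omega
    obtain rfl : w = x := by simpa using hw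
    obtain ⟨x', y', h1, h2, hP⟩ := henclose h
    refine ⟨⟨_, hmem.2 ⟨x', y', k, hP⟩⟩, Finset.card_pair (h1.trans h2).ne,
      ⟨x', by simp, y', by simp, h1, h2⟩, ?_, (hLP _ _ _ _ _ hP).symm⟩
    rintro ⟨B, hB⟩ hc' henc
    obtain ⟨x'', y'', k'', hle'', h'', rfl⟩ := hmem.1 hB
    obtain ⟨h3, h4⟩ := henc.of_pair hle''
    suffices hn : x'' ≤ x' ∧ y' ≤ y'' by
      refine ⟨x'', by simp, y'', by simp, ?_⟩
      simp only [Finset.mem_insert, Finset.mem_singleton]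
      rintro _ (rfl | rfl) <;> omega
    have e1 := hΛ.mono _ _ _ _ _ _ h'' h h3 h4
    have e2 := hΛ.mono _ _ _ _ _ _ hP.2.1 h''
    have e3 := hΛ.noncrossing _ _ _ _ _ _ hP.2.1 h''
    have e4 := hΛ.noncrossing _ _ _ _ _ _ h'' hP.2.1
    have e5 := hΛ.disj _ _ _ _ _ _ h'' hP.2.1
    omega
  · rintro ⟨B, hB⟩ ⟨B', hB'⟩ hc hc' hnest
    obtain ⟨x, y, k, hP⟩ := hmem.1 hB
    obtain ⟨x', y', k', hP'⟩ := hmem.1 hB'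
    rw [hLP _ _ _ _ _ hP, hLP _ _ _ _ _ hP']
    obtain ⟨hle, h, rfl⟩ := hP
    obtain ⟨hle', h', rfl⟩ := hP'
    obtain ⟨h1, h2⟩ := hnest.of_pair hle
    have := hΛ.mono _ _ _ _ _ _ h h' h1 h2
    have := hpair hc'
    omega
  · ext ⟨i, j, l⟩
    rw [mem_blockTriples]
    constructor
    · rintro ⟨x, y, hle, hB, he⟩
      obtain ⟨x', y', k, hP⟩ := hmem.1 hB
      rw [he, hLP _ _ _ _ _ hP]
      obtain ⟨rfl, rfl⟩ := Finset.pair_eq_pair_of_le hle hP.1 hP.2.2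
      exact hP.2.1
    · intro h
      obtain ⟨x, y, k, rfl, rfl, hl, hP⟩ := hlift h
      refine ⟨x, y, hP.1, hmem.2 ⟨x, y, k, hP⟩, ?_⟩
      rw [hLP _ _ _ _ _ hP, hl]

theorem subset_of_blockTriples_eq {m n : ℕ} {π π' : Finset (Finset (Fin n))}
    {L : {B // B ∈ π} → Fin m} {L' : {B // B ∈ π'} → Fin m} (hπ : IsANCPart π)
    (h : blockTriples π L = blockTriples π' L') : π ⊆ π' := by
  intro B hB
  obtain ⟨x, y, hle, rfl⟩ :=
    Finset.exists_eq_pair_of_card_le_two (hπ.1.1 B hB) (hπ.2.2.1 B hB)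
  have := (mk_mem_blockTriples (L := L)).2 ⟨hle, hB, rfl⟩
  rw [h, mk_mem_blockTriples] at this
  exact this.2.1

theorem blockWeight_blockTriples {m n : ℕ} {π : Finset (Finset (Fin n))}
    {L : {B // B ∈ π} → Fin m} (μ : ℝ) :
    blockWeight μ (blockTriples π L) = μ ^ (π.filter fun B => B.card = 1).card := by
  rw [blockWeight, Finset.prod_ite, Finset.prod_const, Finset.prod_const_one, mul_one]
  congr 1
  refine Finset.card_bij (fun t _ => Finset.univ.filter fun z : Fin n => z.val = t.1) ?_ ?_ ?_
  · intro t ht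
    obtain ⟨ht, hd⟩ := Finset.mem_filter.1 ht
    obtain ⟨x, y, -, h, rfl⟩ := mem_blockTriples.1 ht
    obtain rfl : x = y := Fin.val_inj.1 hd
    simpa [Fin.val_inj, Finset.filter_eq'] using h
  · intro t ht t' ht' he
    obtain ⟨ht, hd⟩ := Finset.mem_filter.1 ht
    obtain ⟨x, y, -, h, rfl⟩ := mem_blockTriples.1 ht
    obtain rfl : x = y := Fin.val_inj.1 hd
    obtain ⟨ht', hd'⟩ := Finset.mem_filter.1 ht'
    obtain ⟨x', y', -, h', rfl⟩ := mem_blockTriples.1 ht'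
    obtain rfl : x' = y' := Fin.val_inj.1 hd'
    obtain rfl : x = x' := by simpa [Fin.val_inj, Finset.filter_eq'] using he
    rfl
  · intro B hB
    obtain ⟨hB, hc⟩ := Finset.mem_filter.1 hB
    obtain ⟨x, rfl⟩ := Finset.card_eq_one.1 hc
    have hx : ({x, x} : Finset (Fin n)) ∈ π := by simpa using hB
    exact ⟨(x, x, L ⟨_, hx⟩ + 1),
      Finset.mem_filter.2 ⟨mk_mem_blockTriples.2 ⟨le_rfl, hx, rfl⟩, rfl⟩,
      by simp [Fin.val_inj, Finset.filter_eq']⟩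

theorem gM_eq_labeledSum (m n : ℕ) (μ : ℝ) : gM m n μ = labeledSum μ m 0 0 n := by
  classical
  have : gM m n μ = ∑ s ∈ (Finset.univ : Finset (Finset (Finset (Fin n)))).sigma
      (fun π => (Finset.univ : Finset ({B // B ∈ π} → Fin m))) with IsANCPart s.1 ∧ MLabel s.1 s.2,
      μ ^ (s.1.filter fun B => B.card = 1).card := by
    rw [Finset.sum_filter, Finset.sum_sigma, gM]
    refine Finset.sum_congr rfl fun π _ => ?_
    by_cases h : IsANCPart π
    · simp only [h, if_true, true_and]
    · simp [h]
  rw [this, labeledSum]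
  refine Finset.sum_bij (fun s _ => blockTriples s.1 s.2) ?_ ?_ ?_ ?_
  · intro s hs
    rw [Finset.mem_filter] at hs
    exact mem_labeledOn.2 (isLabeledOn_blockTriples hs.2.1 hs.2.2)
  · rintro ⟨π, L⟩ hs ⟨π', L'⟩ hs' he
    rw [Finset.mem_filter] at hs hs'
    obtain rfl : π = π' := (subset_of_blockTriples_eq hs.2.1 he).antisymm
      (subset_of_blockTriples_eq hs'.2.1 he.symm)
    congr 1
    funext ⟨B, hB⟩
    obtain ⟨x, y, hle, rfl⟩ :=
      Finset.exists_eq_pair_of_card_le_two (hs.2.1.1.1 B hB) (hs.2.1.2.2.1 B hB)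
    have := (mk_mem_blockTriples (L := L)).2 ⟨hle, hB, rfl⟩
    dsimp only at he
    rw [he, mk_mem_blockTriples] at this
    obtain ⟨_, _, h⟩ := this
    exact Fin.ext (by omega)
  · intro Λ hΛ
    obtain ⟨π, L, h1, h2, h3⟩ := exists_blockTriples_eq (mem_labeledOn.1 hΛ)
    exact ⟨⟨π, L⟩, Finset.mem_filter.2 ⟨by simp, h1, h2⟩, h3⟩
  · intro s _
    exact (blockWeight_blockTriples μ).symm

open PowerSeries in
/-- The iterates of the Euler scheme of step `ε` for the equation `W' = -X ^ 2 / W`. -/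
noncomputable def eulerSeries (μ ε : ℝ) : ℕ → PowerSeries ℝ
  | 0 => 1 - C μ * X
  | k + 1 => eulerSeries μ ε k - C ε * (X ^ 2 * (eulerSeries μ ε k)⁻¹)

section eulerSeries

open PowerSeries

@[simp]
theorem constantCoeff_eulerSeries (μ ε : ℝ) (k : ℕ) :
    constantCoeff (eulerSeries μ ε k) = 1 := by
  induction k with
  | zero => simp [eulerSeries]
  | succ k ih => simp [eulerSeries, ih]

theorem eulerSeries_mul_inv (μ ε : ℝ) (k : ℕ) : eulerSeries μ ε k * (eulerSeries μ ε k)⁻¹ = 1 :=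
  PowerSeries.mul_inv_cancel _ (by simp)

theorem eulerSeries_eq_sum (μ ε : ℝ) (k : ℕ) : eulerSeries μ ε k =
    1 - C μ * X - C ε * (X ^ 2 * ∑ j ∈ Finset.range k, (eulerSeries μ ε j)⁻¹) := by
  induction k with
  | zero => simp [eulerSeries]
  | succ k ih =>
    rw [eulerSeries, Finset.sum_range_succ]
    nth_rewrite 1 [ih]
    ring

theorem eulerSeries_sq (μ ε : ℝ) (k : ℕ) : eulerSeries μ ε k ^ 2 =
    (1 - C μ * X) ^ 2 - C (2 * (k * ε)) * X ^ 2
      + X ^ 4 * (C (ε ^ 2) * ∑ j ∈ Finset.range k, (eulerSeries μ ε j)⁻¹ ^ 2) := by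
  induction k with
  | zero => simp [eulerSeries]
  | succ k ih =>
    have h := eulerSeries_mul_inv μ ε k
    rw [eulerSeries, Finset.sum_range_succ, sub_sq, ih]
    simp only [Nat.cast_add, Nat.cast_one, map_mul, map_add, map_pow, map_ofNat, map_one]
    linear_combination (-2 * C ε * X ^ 2) * h

theorem rescale_inv {c : ℝ} {F : PowerSeries ℝ} (hF : constantCoeff F ≠ 0) :
    rescale c F⁻¹ = (rescale c F)⁻¹ := by
  rw [PowerSeries.eq_inv_iff_mul_eq_one, ← map_mul, PowerSeries.inv_mul_cancel _ hF, map_one]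
  rw [← coeff_zero_eq_constantCoeff_apply, coeff_rescale]
  simpa using hF

theorem rescale_C (c a : ℝ) : rescale c (C a : PowerSeries ℝ) = C a := by
  ext n
  rw [coeff_rescale, coeff_C]
  split_ifs with h <;> simp [h]

theorem rescale_eulerSeries (c μ ε : ℝ) (k : ℕ) :
    rescale c (eulerSeries μ ε k) = eulerSeries (c * μ) (c ^ 2 * ε) k := by
  induction k with
  | zero =>
    simp only [eulerSeries, map_sub, map_one, map_mul, rescale_C, rescale_X]
    ring
  | succ k ih =>
    simp only [eulerSeries, map_sub, map_mul, map_pow, rescale_C, rescale_X,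
      rescale_inv (F := eulerSeries μ ε k) (by simp), ih]
    ring

theorem gM_eq_coeff (m n : ℕ) (μ : ℝ) :
    gM m n μ = coeff n (eulerSeries μ 1 m + C μ * X)⁻¹ := by
  let f (p : ℕ) : PowerSeries ℝ :=
    if p = 0 then (eulerSeries μ 1 m + C μ * X)⁻¹ else (eulerSeries μ 1 (m - p))⁻¹
  have hsum : ∀ p ≤ m, ∑ l ∈ Finset.Ioc p m, f l =
      ∑ j ∈ Finset.range (m - p), (eulerSeries μ 1 j)⁻¹ := by
    intro p _
    refine Finset.sum_bij' (fun l _ => m - l) (fun j _ => m - j) ?_ ?_ ?_ ?_ ?_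
    all_goals intro a ha; simp only [Finset.mem_Ioc, Finset.mem_range] at ha ⊢
    · omega
    · omega
    · omega
    · omega
    · simp only [f]
      rw [if_neg (by omega)]
  have hf : ∀ p ≤ m, f p = 1 + X * (C (if p = 0 then 0 else μ) * f p
      + X * ((∑ l ∈ Finset.Ioc p m, f l) * f p)) := by
    intro p hp
    have h1 := eulerSeries_eq_sum μ 1 (m - p)
    rw [← hsum p hp] at h1
    simp only [map_one, one_mul] at h1
    by_cases h0 : p = 0
    · have h2 : f p * (eulerSeries μ 1 (m - p) + C μ * X) = 1 := by
        simp only [f, h0, if_true, Nat.sub_zero]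
        exact PowerSeries.inv_mul_cancel _ (by simp)
      rw [if_pos h0, map_zero]
      rw [h1] at h2
      linear_combination h2
    · have h2 : f p * eulerSeries μ 1 (m - p) = 1 := by
        simp only [f, h0, if_false]
        exact PowerSeries.inv_mul_cancel _ (by simp)
      rw [if_neg h0]
      rw [h1] at h2
      linear_combination h2
  rw [gM_eq_labeledSum]
  simpa [f] using labeledSum_eq_coeff hf n 0 0 (Nat.zero_le m)

theorem rpow_mul_gM {m : ℕ} (hm : m ≠ 0) (n : ℕ) (lam : ℝ) :
    (m : ℝ) ^ (-(n : ℝ) / 2) * gM m n (lam * √m) =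
      coeff n (eulerSeries lam (m : ℝ)⁻¹ m + C lam * X)⁻¹ := by
  have hpos : 0 < √(m : ℝ) := Real.sqrt_pos.2 (by positivity)
  have h1 : (m : ℝ) ^ (-(n : ℝ) / 2) = (√m)⁻¹ ^ n := by
    rw [neg_div, Real.rpow_neg (by positivity), Real.sqrt_eq_rpow, inv_pow, ← Real.rpow_natCast,
      ← Real.rpow_mul (by positivity)]
    congr 2
    ring
  rw [h1, gM_eq_coeff, ← coeff_rescale, rescale_inv (by simp), map_add, rescale_eulerSeries,
    map_mul, rescale_C, rescale_X]
  have h2 : (√(m : ℝ))⁻¹ ^ 2 * 1 = (m : ℝ)⁻¹ := by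
    rw [mul_one, inv_pow, Real.sq_sqrt (by positivity)]
  have h3 : (√(m : ℝ))⁻¹ * (lam * √m) = lam := by field_simp
  have h4 : (C (lam * √m) : PowerSeries ℝ) * (C (√(m : ℝ))⁻¹ * X) = C lam * X := by
    rw [← mul_assoc, ← map_mul]; congr 2; field_simp
  rw [h2, h3, h4]

end eulerSeries

section Bounded

variable {ι : Type*}

/-- A uniformly bounded family of real numbers. -/
def IsBddFamily (x : ι → ℝ) : Prop := ∃ B, ∀ i, |x i| ≤ B

theorem isBddFamily_const (c : ℝ) : IsBddFamily fun _ : ι => c := ⟨|c|, fun _ => le_rfl⟩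

theorem IsBddFamily.add {x y : ι → ℝ} (hx : IsBddFamily x) (hy : IsBddFamily y) :
    IsBddFamily fun i => x i + y i := by
  obtain ⟨A, hA⟩ := hx
  obtain ⟨B, hB⟩ := hy
  exact ⟨A + B, fun i => (abs_add_le _ _).trans (add_le_add (hA i) (hB i))⟩

theorem IsBddFamily.mul {x y : ι → ℝ} (hx : IsBddFamily x) (hy : IsBddFamily y) :
    IsBddFamily fun i => x i * y i := by
  obtain ⟨A, hA⟩ := hx
  obtain ⟨B, hB⟩ := hy
  refine ⟨A * B, fun i => ?_⟩
  rw [abs_mul]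
  exact mul_le_mul (hA i) (hB i) (abs_nonneg _) ((abs_nonneg _).trans (hA i))

theorem IsBddFamily.sum {κ : Type*} {s : Finset κ} {x : κ → ι → ℝ}
    (hx : ∀ k ∈ s, IsBddFamily (x k)) : IsBddFamily fun i => ∑ k ∈ s, x k i := by
  classical
  induction s using Finset.induction_on with
  | empty => simpa using isBddFamily_const 0
  | insert a s ha ih =>
    simp_rw [Finset.sum_insert ha]
    exact (hx a (by simp)).add (ih fun k hk => hx k (by simp [hk]))

open PowerSeries

theorem IsBddFamily.coeff_mul {f g : ι → PowerSeries ℝ} {n : ℕ}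
    (hf : ∀ k ≤ n, IsBddFamily fun i => coeff k (f i))
    (hg : ∀ k ≤ n, IsBddFamily fun i => coeff k (g i)) :
    IsBddFamily fun i => coeff n (f i * g i) := by
  simp_rw [PowerSeries.coeff_mul]
  refine IsBddFamily.sum fun p hp => ?_
  rw [Finset.HasAntidiagonal.mem_antidiagonal] at hp
  exact (hf _ (by omega)).mul (hg _ (by omega))

theorem IsBddFamily.coeff_inv {f : ι → PowerSeries ℝ} {c : ℝ} (hc : c ≠ 0)
    (hfc : ∀ i, constantCoeff (f i) = c) {n : ℕ}
    (hf : ∀ k ≤ n, IsBddFamily fun i => coeff k (f i)) :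
    IsBddFamily fun i => coeff n (f i)⁻¹ := by
  induction n using Nat.strong_induction_on with
  | _ n ih =>
  have h : ∀ i, coeff n (f i)⁻¹ = coeff n (C c⁻¹ : PowerSeries ℝ) +
      ∑ p ∈ Finset.HasAntidiagonal.antidiagonal n, coeff p.1 (1 - C c⁻¹ * f i) * coeff p.2 (f i)⁻¹ := by
    intro i
    have h1 := PowerSeries.mul_inv_cancel (f i) (by rwa [hfc])
    rw [← PowerSeries.coeff_mul, ← map_add]
    congr 1
    linear_combination (C c⁻¹ : PowerSeries ℝ) * h1
  simp_rw [h]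
  refine (isBddFamily_const _).add (IsBddFamily.sum fun p hp => ?_)
  rw [Finset.HasAntidiagonal.mem_antidiagonal] at hp
  by_cases h0 : p.1 = 0
  · convert isBddFamily_const (ι := ι) 0 using 2 with i
    rw [h0]
    simp [hfc, hc]
  · have h1 : IsBddFamily fun i => coeff p.1 (1 - C c⁻¹ * f i) := by
      have h2 : ∀ i, coeff p.1 (1 - C c⁻¹ * f i) =
          coeff p.1 (1 : PowerSeries ℝ) + -c⁻¹ * coeff p.1 (f i) := fun i => by
        rw [map_sub, coeff_C_mul]
        ring
      simp_rw [h2]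
      exact (isBddFamily_const _).add ((isBddFamily_const _).mul (hf p.1 (by omega)))
    exact h1.mul (ih _ (by omega) fun k hk => hf k (by omega))

theorem isBddFamily_coeff_eulerSeries (lam : ℝ) (n : ℕ) :
    IsBddFamily fun q : {q : ℕ × ℕ // q.2 ≤ q.1} =>
      coeff n (eulerSeries lam (q.1.1 : ℝ)⁻¹ q.1.2) := by
  induction n using Nat.strong_induction_on with
  | _ n ih =>
  rcases lt_or_ge n 2 with hn | hn
  · convert isBddFamily_const (coeff n (1 - C lam * X : PowerSeries ℝ)) using 2 with q
    rw [eulerSeries_eq_sum, map_sub, coeff_C_mul, coeff_X_pow_mul', if_neg (by omega), mul_zero,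
      sub_zero]
  · obtain ⟨B, hB⟩ := IsBddFamily.coeff_inv one_ne_zero (fun q => constantCoeff_eulerSeries _ _ _)
      (n := n - 2) fun k hk => ih k (by omega)
    refine ⟨|coeff n (1 - C lam * X : PowerSeries ℝ)| + B, ?_⟩
    rintro ⟨⟨m, k⟩, hk⟩
    have hB0 : 0 ≤ B := (abs_nonneg _).trans (hB ⟨(0, 0), le_rfl⟩)
    dsimp only at hk ⊢
    rw [eulerSeries_eq_sum, map_sub, coeff_C_mul, coeff_X_pow_mul', if_pos hn, map_sum]
    refine (abs_sub _ _).trans (add_le_add le_rfl ?_)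
    rw [abs_mul, abs_of_nonneg (by positivity : (0 : ℝ) ≤ (m : ℝ)⁻¹)]
    have h1 : |∑ j ∈ Finset.range k, coeff (n - 2) (eulerSeries lam (m : ℝ)⁻¹ j)⁻¹| ≤ m * B := by
      refine (Finset.abs_sum_le_sum_abs _ _).trans ((Finset.sum_le_sum (g := fun _ => B) ?_).trans ?_)
      · intro j hj
        rw [Finset.mem_range] at hj
        exact hB ⟨(m, j), by dsimp only; omega⟩
      · rw [Finset.sum_const, Finset.card_range, nsmul_eq_mul]
        gcongr
    calc (m : ℝ)⁻¹ * _ ≤ (m : ℝ)⁻¹ * (m * B) := by gcongr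
      _ = ((m : ℝ)⁻¹ * m) * B := by ring
      _ ≤ 1 * B := by gcongr; exact inv_mul_le_one
      _ = B := one_mul B

theorem tendsto_coeff_mul_zero {f g : ℕ → PowerSeries ℝ}
    (hf : ∀ n, Filter.Tendsto (fun i => coeff n (f i)) Filter.atTop (nhds 0))
    (hg : ∀ n, IsBddFamily fun i => coeff n (g i)) (n : ℕ) :
    Filter.Tendsto (fun i => coeff n (f i * g i)) Filter.atTop (nhds 0) := by
  simp_rw [PowerSeries.coeff_mul]
  rw [← Finset.sum_const_zero (s := Finset.HasAntidiagonal.antidiagonal n)]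
  refine tendsto_finsetSum _ fun p _ => ?_
  obtain ⟨B, hB⟩ := hg p.2
  refine squeeze_zero_norm (a := fun i => |coeff p.1 (f i)| * B) (fun i => ?_) ?_
  · rw [Real.norm_eq_abs, abs_mul]
    exact mul_le_mul_of_nonneg_left (hB i) (abs_nonneg _)
  · simpa using ((hf p.1).abs).mul_const B

theorem tendsto_coeff_eulerSeries_sq_sub (lam : ℝ) (n : ℕ) :
    Filter.Tendsto (fun m : ℕ => coeff n (eulerSeries lam (m : ℝ)⁻¹ m ^ 2 -
      ((1 - C lam * X) ^ 2 - C 2 * X ^ 2))) Filter.atTop (nhds 0) := by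
  have hinv : ∀ n, IsBddFamily fun q : {q : ℕ × ℕ // q.2 ≤ q.1} =>
      coeff n (eulerSeries lam (q.1.1 : ℝ)⁻¹ q.1.2)⁻¹ := fun n =>
    IsBddFamily.coeff_inv one_ne_zero (fun q => constantCoeff_eulerSeries _ _ _)
      fun k _ => isBddFamily_coeff_eulerSeries lam k
  obtain ⟨B, hB⟩ := IsBddFamily.coeff_mul (n := n - 4) (fun k _ => hinv k) fun k _ => hinv k
  have hB0 : 0 ≤ B := (abs_nonneg _).trans (hB ⟨(0, 0), le_rfl⟩)
  refine squeeze_zero_norm' (a := fun m : ℕ => (m : ℝ)⁻¹ * B) ?_ ?_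
  · filter_upwards [Filter.eventually_ne_atTop 0] with m hm
    have hm' : (m : ℝ) ≠ 0 := by exact_mod_cast hm
    rw [eulerSeries_sq, mul_inv_cancel₀ hm', mul_one, add_sub_cancel_left, coeff_X_pow_mul',
      Real.norm_eq_abs]
    split_ifs
    · rw [coeff_C_mul, map_sum, abs_mul, abs_of_nonneg (by positivity)]
      have h1 : |∑ j ∈ Finset.range m, coeff (n - 4) ((eulerSeries lam (m : ℝ)⁻¹ j)⁻¹ ^ 2)| ≤
          m * B := by
        refine (Finset.abs_sum_le_sum_abs _ _).trans
          ((Finset.sum_le_sum (g := fun _ => B) ?_).trans ?_)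
        · intro j hj
          rw [Finset.mem_range] at hj
          rw [sq]
          exact hB ⟨(m, j), by dsimp only; omega⟩
        · rw [Finset.sum_const, Finset.card_range, nsmul_eq_mul]
      calc _ ≤ (m : ℝ)⁻¹ ^ 2 * (m * B) := by gcongr
        _ = (m : ℝ)⁻¹ * B := by field_simp
    · rw [abs_zero]
      positivity
  · simpa using (tendsto_inv_atTop_nhds_zero_nat (𝕜 := ℝ)).mul_const B

/-- If `s` is the square root of `(1 - λ X)² - 2 X²`, the renormalized counts converge to the
coefficients of `1 / (s + λ X)`. -/
theorem tendsto_gM {lam : ℝ} {s M : PowerSeries ℝ} (hs0 : constantCoeff s = 1)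
    (hs : s ^ 2 = (1 - C lam * X) ^ 2 - C 2 * X ^ 2) (hM : M * (s + C lam * X) = 1) (n : ℕ) :
    Filter.Tendsto (fun m : ℕ => (m : ℝ) ^ (-(n : ℝ) / 2) * gM m n (lam * √m))
      Filter.atTop (nhds (coeff n M)) := by
  let W (m : ℕ) : PowerSeries ℝ := eulerSeries lam (m : ℝ)⁻¹ m
  have hW0 : ∀ m, constantCoeff (W m) = 1 := fun m => constantCoeff_eulerSeries _ _ _
  have hWb : ∀ n, IsBddFamily fun m => coeff n (W m) := fun n =>
    (isBddFamily_coeff_eulerSeries lam n).imp fun B hB m => hB ⟨(m, m), le_rfl⟩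
  have hadd : ∀ (t : PowerSeries ℝ) n, IsBddFamily fun m => coeff n (W m + t) := fun t n => by
    simp only [map_add]
    exact (hWb n).add (isBddFamily_const _)
  have hWs : ∀ n, Filter.Tendsto (fun m => coeff n (W m - s)) Filter.atTop (nhds 0) := by
    intro n
    have h := tendsto_coeff_mul_zero (g := fun m => (W m + s)⁻¹)
      (tendsto_coeff_eulerSeries_sq_sub lam) (fun n => IsBddFamily.coeff_inv two_ne_zero
        (fun m => by rw [map_add, hW0, hs0]; norm_num) fun k _ => hadd s k) n
    refine h.congr fun m => ?_
    congr 1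
    have h1 := PowerSeries.mul_inv_cancel (W m + s) (by rw [map_add, hW0, hs0]; norm_num)
    rw [← hs]
    linear_combination (W m - s) * h1
  have hGb : ∀ n, IsBddFamily fun m => coeff n (-M * (W m + C lam * X)⁻¹) := fun n =>
    IsBddFamily.coeff_mul (fun k _ => isBddFamily_const _) fun k _ =>
      IsBddFamily.coeff_inv one_ne_zero (fun m => by simp [hW0]) fun k _ => hadd _ k
  have h := (tendsto_coeff_mul_zero hWs hGb n).add_const (coeff n M)
  rw [zero_add] at h
  refine h.congr' ?_
  filter_upwards [Filter.eventually_ne_atTop 0] with m hm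
  rw [rpow_mul_gM hm, ← map_add]
  congr 1
  have h1 := PowerSeries.mul_inv_cancel (W m + C lam * X) (by simp [hW0])
  change _ = (W m + C lam * X)⁻¹
  linear_combination (-M) * h1 + (W m + C lam * X)⁻¹ * hM

end Bounded

section Moments

open intervalIntegral

/-- The `n`-th moment of the semicircle law of mean `lam` and radius `√2`. -/
noncomputable def semicircleMoment (lam : ℝ) (n : ℕ) : ℝ :=
  Real.pi⁻¹ * ∫ x in (lam - √2)..(lam + √2), x ^ n * √(2 - (x - lam) ^ 2)

theorem two_sub_sq_pos {lam x : ℝ} (hx : x ∈ Set.Ioo (lam - √2) (lam + √2)) :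
    0 < 2 - (x - lam) ^ 2 := by
  have h2 : √2 ^ 2 = (2 : ℝ) := Real.sq_sqrt (by norm_num)
  nlinarith [hx.1, hx.2]

theorem two_sub_sq_nonneg {lam x : ℝ} (hx : x ∈ Set.Icc (lam - √2) (lam + √2)) :
    0 ≤ 2 - (x - lam) ^ 2 := by
  have h2 : √2 ^ 2 = (2 : ℝ) := Real.sq_sqrt (by norm_num)
  nlinarith [hx.1, hx.2]

theorem sub_sqrt_two_le_add (lam : ℝ) : lam - √2 ≤ lam + √2 := by
  linarith [Real.sqrt_nonneg 2]

theorem semicircleMoment_zero (lam : ℝ) : semicircleMoment lam 0 = 1 := by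
  have h2 : √2 ^ 2 = (2 : ℝ) := Real.sq_sqrt (by norm_num)
  have h := integral_comp_mul_add (a := -1) (b := 1) (fun x => √(2 - (x - lam) ^ 2))
    (c := √2) (by positivity) lam
  have h3 : ∀ x : ℝ, √(2 - (√2 * x + lam - lam) ^ 2) = √2 * √(1 - x ^ 2) := fun x => by
    rw [← Real.sqrt_mul (by norm_num)]
    congr 1
    rw [add_sub_cancel_right, mul_pow, h2]
    ring
  simp_rw [h3] at h
  rw [intervalIntegral.integral_const_mul, integral_sqrt_one_sub_sq] at h
  have h4 : √2 * -1 + lam = lam - √2 := by ring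
  have h5 : √2 * 1 + lam = lam + √2 := by ring
  rw [h4, h5, smul_eq_mul] at h
  have h6 : ∫ x in (lam - √2)..(lam + √2), √(2 - (x - lam) ^ 2) = Real.pi := by
    have : √2 ≠ 0 := by positivity
    field_simp at h
    linear_combination -h / 2 + Real.pi / 2 * h2
  simp only [semicircleMoment, pow_zero, one_mul, h6]
  exact inv_mul_cancel₀ Real.pi_ne_zero

theorem semicircleMoment_succ (lam : ℝ) (n : ℕ) :
    ((n : ℝ) + 3) * semicircleMoment lam (n + 1) = (2 * n + 3) * lam * semicircleMoment lam n +
      n * (2 - lam ^ 2) * semicircleMoment lam (n - 1) := by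
  have hi : ∀ k : ℕ, IntervalIntegrable (fun x => x ^ k * √(2 - (x - lam) ^ 2)) volume
      (lam - √2) (lam + √2) := fun k => Continuous.intervalIntegrable (by fun_prop) _ _
  have h := integral_eq_sub_of_hasDerivAt_of_le (sub_sqrt_two_le_add lam)
    (f := fun x => x ^ n * ((2 - (x - lam) ^ 2) * √(2 - (x - lam) ^ 2)))
    (f' := fun x => ((2 * n + 3) * lam) * (x ^ n * √(2 - (x - lam) ^ 2)) +
      (n * (2 - lam ^ 2)) * (x ^ (n - 1) * √(2 - (x - lam) ^ 2)) -
      (n + 3) * (x ^ (n + 1) * √(2 - (x - lam) ^ 2)))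
    (by fun_prop) ?_ ((((hi n).const_mul _).add ((hi _).const_mul _)).sub ((hi _).const_mul _))
  · rw [intervalIntegral.integral_sub (((hi n).const_mul _).add ((hi _).const_mul _))
      ((hi _).const_mul _), intervalIntegral.integral_add ((hi n).const_mul _)
      ((hi _).const_mul _)] at h
    simp only [intervalIntegral.integral_const_mul] at h
    have h2 : √2 ^ 2 = (2 : ℝ) := Real.sq_sqrt (by norm_num)
    rw [add_sub_cancel_left, sub_sub_cancel_left, neg_sq, h2] at h
    simp only [sub_self, zero_mul, mul_zero] at h
    simp only [semicircleMoment]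
    linear_combination -Real.pi⁻¹ * h
  · intro x hx
    have hpos := two_sub_sq_pos hx
    have hs := Real.sq_sqrt hpos.le
    have hs0 : √(2 - (x - lam) ^ 2) ≠ 0 := (Real.sqrt_pos.2 hpos).ne'
    have hD : HasDerivAt (fun x : ℝ => 2 - (x - lam) ^ 2) (-(2 * (x - lam))) x := by
      simpa using (((hasDerivAt_id x).sub_const lam).pow 2).const_sub 2
    refine ((hasDerivAt_pow n x).fun_mul (hD.fun_mul (hD.sqrt hpos.ne'))).congr_deriv ?_
    have hn : (n : ℝ) * x ^ n = n * (x ^ (n - 1) * x) := by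
      rcases n with _ | n
      · simp
      · rw [Nat.add_sub_cancel, pow_succ]
    have h1 : ∀ r : ℝ, r ^ 2 = 2 - (x - lam) ^ 2 → r ≠ 0 →
        (2 - (x - lam) ^ 2) * (-(2 * (x - lam)) / (2 * r)) = -((x - lam) * r) := by
      intro r hr hr0
      rw [← hr]
      field_simp
    rw [h1 _ hs hs0]
    linear_combination (√(2 - (x - lam) ^ 2) * (x - 2 * lam)) * hn

/-- The density of the absolutely continuous part of `nuMeas lam` on its support. -/
noncomputable def nuDensity (lam x : ℝ) : ℝ :=
  √(2 - (x - lam) ^ 2) / (Real.pi * (lam ^ 2 + 2 - (x - lam) ^ 2))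

theorem nuDensity_den_pos {lam x : ℝ} (hlam : 0 < lam)
    (hx : x ∈ Set.Icc (lam - √2) (lam + √2)) :
    0 < lam ^ 2 + 2 - (x - lam) ^ 2 := by
  have := two_sub_sq_nonneg hx
  nlinarith

theorem continuousOn_nuDensity {lam : ℝ} (hlam : 0 < lam) :
    ContinuousOn (nuDensity lam) (Set.Icc (lam - √2) (lam + √2)) := by
  unfold nuDensity
  refine ContinuousOn.div (by fun_prop) (by fun_prop) fun x hx => ?_
  exact (mul_pos Real.pi_pos (nuDensity_den_pos hlam hx)).ne'

theorem intervalIntegrable_mul_nuDensity {lam : ℝ} (hlam : 0 < lam) {f : ℝ → ℝ}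
    (hf : Continuous f) :
    IntervalIntegrable (fun x => f x * nuDensity lam x) volume (lam - √2) (lam + √2) := by
  refine ContinuousOn.intervalIntegrable ?_
  rw [Set.uIcc_of_le (sub_sqrt_two_le_add lam)]
  exact hf.continuousOn.mul (continuousOn_nuDensity hlam)

theorem integral_nuAC {lam : ℝ} (hlam : 0 < lam) (f : ℝ → ℝ) :
    ∫ x, f x ∂(nuAC lam) = ∫ x in (lam - √2)..(lam + √2), f x * nuDensity lam x := by
  classical
  rw [nuAC, integral_withDensity_eq_integral_toReal_smul ?_ (by simp)]
  · rw [intervalIntegral.integral_of_le (sub_sqrt_two_le_add lam),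
      MeasureTheory.integral_Ioc_eq_integral_Ioo,
      ← MeasureTheory.integral_indicator measurableSet_Ioo]
    congr 1 with x
    by_cases hx : x ∈ Set.Ioo (lam - √2) (lam + √2)
    · have := nuDensity_den_pos hlam (Set.Ioo_subset_Icc_self hx)
      rw [Set.indicator_of_mem hx, if_pos hx, ENNReal.toReal_ofReal (by positivity), smul_eq_mul,
        mul_comm, nuDensity]
    · rw [Set.indicator_of_notMem hx, if_neg hx]
      simp
  · refine ENNReal.measurable_ofReal.comp (Measurable.ite measurableSet_Ioo ?_ measurable_const)
    fun_prop

theorem integrable_nuAC {lam : ℝ} (hlam : 0 < lam) {f : ℝ → ℝ} (hf : Continuous f) :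
    Integrable f (nuAC lam) := by
  classical
  rw [nuAC, integrable_withDensity_iff_integrable_smul' ?_ (by simp)]
  · have h := intervalIntegrable_mul_nuDensity hlam hf
    rw [intervalIntegrable_iff_integrableOn_Ioo_of_le (sub_sqrt_two_le_add lam),
      ← integrable_indicator_iff measurableSet_Ioo] at h
    refine h.congr (Filter.Eventually.of_forall fun x => ?_)
    dsimp only
    by_cases hx : x ∈ Set.Ioo (lam - √2) (lam + √2)
    · have := nuDensity_den_pos hlam (Set.Ioo_subset_Icc_self hx)
      rw [Set.indicator_of_mem hx, if_pos hx, ENNReal.toReal_ofReal (by positivity), smul_eq_mul,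
        mul_comm, nuDensity]
    · rw [Set.indicator_of_notMem hx, if_neg hx]
      simp
  · refine ENNReal.measurable_ofReal.comp (Measurable.ite measurableSet_Ioo ?_ measurable_const)
    fun_prop

theorem integral_nuMeas {lam : ℝ} (hlam : 0 < lam) {f : ℝ → ℝ} (hf : Continuous f) :
    ∫ x, f x ∂(nuMeas lam) = lam / √(lam ^ 2 + 2) * f (lam - √(lam ^ 2 + 2)) +
      ∫ x in (lam - √2)..(lam + √2), f x * nuDensity lam x := by
  rw [nuMeas, integral_add_measure ?_ (integrable_nuAC hlam hf),
    MeasureTheory.integral_smul_measure,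
    integral_dirac, integral_nuAC hlam, ENNReal.toReal_ofReal (by positivity), smul_eq_mul]
  exact (integrable_dirac (by simp)).smul_measure ENNReal.ofReal_ne_top

theorem moment_nuMeas_add_two {lam : ℝ} (hlam : 0 < lam) (n : ℕ) :
    ∫ x, x ^ (n + 2) ∂(nuMeas lam) = 2 * lam * ∫ x, x ^ (n + 1) ∂(nuMeas lam) +
      2 * ∫ x, x ^ n ∂(nuMeas lam) - semicircleMoment lam n := by
  have hi := fun k : ℕ => intervalIntegrable_mul_nuDensity hlam (continuous_pow k)
  have h : semicircleMoment lam n = ∫ x in (lam - √2)..(lam + √2),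
      ((2 * lam) * (x ^ (n + 1) * nuDensity lam x) + 2 * (x ^ n * nuDensity lam x) -
        x ^ (n + 2) * nuDensity lam x) := by
    rw [semicircleMoment, ← intervalIntegral.integral_const_mul]
    refine intervalIntegral.integral_congr fun x hx => ?_
    rw [Set.uIcc_of_le (sub_sqrt_two_le_add lam)] at hx
    have h0 := nuDensity_den_pos hlam hx
    have h1 : (lam ^ 2 + 2 - (x - lam) ^ 2) * nuDensity lam x =
        Real.pi⁻¹ * √(2 - (x - lam) ^ 2) := by
      rw [nuDensity]
      field_simp
    linear_combination (-x ^ n) * h1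
  rw [intervalIntegral.integral_sub (((hi _).const_mul _).add ((hi _).const_mul _)) (hi _),
    intervalIntegral.integral_add ((hi _).const_mul _) ((hi _).const_mul _),
    intervalIntegral.integral_const_mul, intervalIntegral.integral_const_mul] at h
  simp only [integral_nuMeas hlam (continuous_pow _), h]
  have hs : √(lam ^ 2 + 2) ^ 2 = lam ^ 2 + 2 := Real.sq_sqrt (by positivity)
  linear_combination (lam / √(lam ^ 2 + 2) * (lam - √(lam ^ 2 + 2)) ^ n) * hs

theorem hasDerivAt_arctan_mul_div_sqrt (k : ℝ) {u : ℝ} (hu : 0 < 2 - u ^ 2) :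
    HasDerivAt (fun u => Real.arctan (k * (u / √(2 - u ^ 2))))
      (2 * k / (√(2 - u ^ 2) * (2 - (1 - k ^ 2) * u ^ 2))) u := by
  have hs := Real.sq_sqrt hu.le
  have hs0 : 0 < √(2 - u ^ 2) := Real.sqrt_pos.2 hu
  have hD : HasDerivAt (fun x : ℝ => 2 - x ^ 2) (-(2 * u)) u := by
    simpa using ((hasDerivAt_id u).pow 2).const_sub 2
  refine (((hasDerivAt_id' u).fun_div (hD.sqrt hu.ne') hs0.ne').const_mul k).arctan.congr_deriv ?_
  have h1 : 0 < 2 - (1 - k ^ 2) * u ^ 2 := by nlinarith [mul_nonneg (sq_nonneg k) (sq_nonneg u)]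
  have h2 : 2 - (1 - k ^ 2) * u ^ 2 = √(2 - u ^ 2) ^ 2 + k ^ 2 * u ^ 2 := by rw [hs]; ring
  have h3 : (2 : ℝ) = √(2 - u ^ 2) ^ 2 + u ^ 2 := by rw [hs]; ring
  rw [h2] at h1 ⊢
  generalize √(2 - u ^ 2) = r at *
  have h4 : 0 < 1 + (k * (u / r)) ^ 2 := by positivity
  field_simp
  linear_combination -k * h3

theorem tendsto_div_sqrt_right :
    Filter.Tendsto (fun u : ℝ => u / √(2 - u ^ 2)) (nhdsWithin √2 (Set.Iio √2)) Filter.atTop := by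
  have h2 : √2 ^ 2 = (2 : ℝ) := Real.sq_sqrt (by norm_num)
  have h1 : Filter.Tendsto (fun u : ℝ => √(2 - u ^ 2)) (nhdsWithin √2 (Set.Iio √2))
      (nhdsWithin 0 (Set.Ioi 0)) := by
    refine tendsto_nhdsWithin_iff.2 ⟨?_, ?_⟩
    · have : Continuous fun u : ℝ => √(2 - u ^ 2) := by fun_prop
      refine (this.tendsto' _ _ ?_).mono_left nhdsWithin_le_nhds
      simp
    · have h0 : (0 : ℝ) < √2 := by positivity
      filter_upwards [Ioo_mem_nhdsLT h0] with u hu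
      refine Real.sqrt_pos.2 ?_
      nlinarith [hu.1, hu.2]
  simp_rw [div_eq_mul_inv]
  refine Filter.Tendsto.pos_mul_atTop (C := √2) (by positivity) ?_ h1.inv_tendsto_nhdsGT_zero
  exact Filter.tendsto_id.mono_left nhdsWithin_le_nhds

theorem tendsto_div_sqrt_left :
    Filter.Tendsto (fun u : ℝ => u / √(2 - u ^ 2)) (nhdsWithin (-√2) (Set.Ioi (-√2)))
      Filter.atBot := by
  have h := (Filter.tendsto_neg_atTop_atBot.comp tendsto_div_sqrt_right).comp
    (tendsto_neg_nhdsGT_neg (a := √2))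
  refine h.congr fun u => ?_
  simp [neg_div]

theorem integral_sqrt_div {lam : ℝ} (hlam : 0 < lam) :
    ∫ u in (-√2)..√2, √(2 - u ^ 2) / (lam ^ 2 + 2 - u ^ 2) =
      Real.pi * (1 - lam / √(lam ^ 2 + 2)) := by
  have h2 : √2 ^ 2 = (2 : ℝ) := Real.sq_sqrt (by norm_num)
  have h20 : 0 < √(2 : ℝ) := by positivity
  have hr : √(lam ^ 2 + 2) ^ 2 = lam ^ 2 + 2 := Real.sq_sqrt (by positivity)
  have hr0 : 0 < √(lam ^ 2 + 2) := by positivity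
  have hc : 0 < lam / √(lam ^ 2 + 2) := by positivity
  have hk : (lam / √(lam ^ 2 + 2)) ^ 2 = lam ^ 2 / (lam ^ 2 + 2) := by rw [div_pow, hr]
  set c := lam / √(lam ^ 2 + 2)
  have key := integral_eq_sub_of_hasDerivAt_of_tendsto (a := -√2) (b := √2)
    (f := fun u => Real.arctan (1 * (u / √(2 - u ^ 2))) - c * Real.arctan (c * (u / √(2 - u ^ 2))))
    (f' := fun u => √(2 - u ^ 2) / (lam ^ 2 + 2 - u ^ 2))
    (fa := -(Real.pi / 2) - c * -(Real.pi / 2)) (fb := Real.pi / 2 - c * (Real.pi / 2))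
    (by linarith) ?_ ?_ ?_ ?_
  · rw [key]
    ring
  · intro u hu
    have hpos : 0 < 2 - u ^ 2 := by nlinarith [hu.1, hu.2]
    refine ((hasDerivAt_arctan_mul_div_sqrt 1 hpos).fun_sub
      ((hasDerivAt_arctan_mul_div_sqrt c hpos).const_mul c)).congr_deriv ?_
    have hs := Real.sq_sqrt hpos.le
    have hs0 : 0 < √(2 - u ^ 2) := Real.sqrt_pos.2 hpos
    have h4 : 0 < lam ^ 2 + 2 - u ^ 2 := by nlinarith
    have h5 : 2 - (1 - c ^ 2) * u ^ 2 = 2 / (lam ^ 2 + 2) * (lam ^ 2 + 2 - u ^ 2) := by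
      rw [hk]
      field_simp
      ring
    have h6 : c * (2 * c / (√(2 - u ^ 2) * (2 - (1 - c ^ 2) * u ^ 2))) =
        lam ^ 2 / (√(2 - u ^ 2) * (lam ^ 2 + 2 - u ^ 2)) := by
      rw [h5, mul_div_assoc', show c * (2 * c) = 2 * c ^ 2 by ring, hk]
      field_simp
    rw [h6]
    generalize √(2 - u ^ 2) = r at *
    field_simp
    linear_combination -2 * hs
  · refine ContinuousOn.intervalIntegrable ?_
    rw [Set.uIcc_of_le (by linarith)]
    refine ContinuousOn.div (by fun_prop) (by fun_prop) fun u hu => ne_of_gt ?_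
    nlinarith [hu.1, hu.2]
  · simp only [one_mul]
    exact ((Real.tendsto_arctan_atBot.mono_right nhdsWithin_le_nhds).comp
      tendsto_div_sqrt_left).sub (((Real.tendsto_arctan_atBot.mono_right nhdsWithin_le_nhds).comp
      (tendsto_div_sqrt_left.const_mul_atBot hc)).const_mul c)
  · simp only [one_mul]
    exact ((Real.tendsto_arctan_atTop.mono_right nhdsWithin_le_nhds).comp
      tendsto_div_sqrt_right).sub (((Real.tendsto_arctan_atTop.mono_right nhdsWithin_le_nhds).comp
      (tendsto_div_sqrt_right.const_mul_atTop hc)).const_mul c)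

theorem integral_nuDensity {lam : ℝ} (hlam : 0 < lam) :
    ∫ x in (lam - √2)..(lam + √2), nuDensity lam x = 1 - lam / √(lam ^ 2 + 2) := by
  have h := intervalIntegral.integral_comp_sub_right (a := lam - √2) (b := lam + √2)
    (fun u => √(2 - u ^ 2) / (lam ^ 2 + 2 - u ^ 2)) lam
  rw [add_sub_cancel_left, sub_sub_cancel_left, integral_sqrt_div hlam] at h
  have h1 : ∀ x, nuDensity lam x =
      Real.pi⁻¹ * (√(2 - (x - lam) ^ 2) / (lam ^ 2 + 2 - (x - lam) ^ 2)) := fun x => by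
    rw [nuDensity, div_mul_eq_div_div_swap]
    ring
  simp_rw [h1]
  rw [intervalIntegral.integral_const_mul, h, inv_mul_cancel_left₀ Real.pi_ne_zero]

theorem integral_sub_mul_nuDensity (lam : ℝ) :
    ∫ x in (lam - √2)..(lam + √2), (x - lam) * nuDensity lam x = 0 := by
  let f (u : ℝ) : ℝ := u * (√(2 - u ^ 2) / (Real.pi * (lam ^ 2 + 2 - u ^ 2)))
  have h := intervalIntegral.integral_comp_sub_right (a := lam - √2) (b := lam + √2) f lam
  have h' := intervalIntegral.integral_comp_neg (a := -√2) (b := √2) f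
  have hf : ∀ u, f (-u) = -f u := fun u => by simp only [f, neg_sq, neg_mul]
  simp only [hf, intervalIntegral.integral_neg, neg_neg] at h'
  rw [add_sub_cancel_left, sub_sub_cancel_left] at h
  simp only [f] at h h'
  simp only [nuDensity]
  rw [h]
  linarith

theorem moment_nuMeas_zero {lam : ℝ} (hlam : 0 < lam) : ∫ x, x ^ 0 ∂(nuMeas lam) = 1 := by
  rw [integral_nuMeas hlam (continuous_pow 0)]
  simp only [pow_zero, one_mul, integral_nuDensity hlam]
  ring

theorem moment_nuMeas_one {lam : ℝ} (hlam : 0 < lam) : ∫ x, x ^ 1 ∂(nuMeas lam) = 0 := by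
  have h : ∫ x in (lam - √2)..(lam + √2), x ^ 1 * nuDensity lam x =
      ∫ x in (lam - √2)..(lam + √2), ((x - lam) * nuDensity lam x + lam * nuDensity lam x) := by
    congr 1 with x
    ring
  rw [integral_nuMeas hlam (continuous_pow 1), h, intervalIntegral.integral_add
    (intervalIntegrable_mul_nuDensity hlam (by fun_prop))
    (intervalIntegrable_mul_nuDensity hlam (by fun_prop)), integral_sub_mul_nuDensity,
    intervalIntegral.integral_const_mul, integral_nuDensity hlam]
  have hr0 : 0 < √(lam ^ 2 + 2) := by positivity
  field_simp
  ring

open PowerSeries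

/-- The power series square root of `(1 - λ X)² - 2 X²`. -/
noncomputable def sqrtSeries (lam : ℝ) : PowerSeries ℝ :=
  1 - C lam * X - X ^ 2 * mk (semicircleMoment lam)

theorem constantCoeff_sqrtSeries (lam : ℝ) : constantCoeff (sqrtSeries lam) = 1 := by
  simp [sqrtSeries]

theorem coeff_one_sqrtSeries (lam : ℝ) : coeff 1 (sqrtSeries lam) = -lam := by
  simp [sqrtSeries, coeff_X_pow_mul', coeff_one]

theorem coeff_add_two_sqrtSeries (lam : ℝ) (n : ℕ) :
    coeff (n + 2) (sqrtSeries lam) = -semicircleMoment lam n := by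
  rw [sqrtSeries, map_sub, map_sub, coeff_C_mul, coeff_X, coeff_one, coeff_X_pow_mul, coeff_mk]
  simp

theorem coeff_add_three_sqrtSeries (lam : ℝ) (n : ℕ) :
    ((n : ℝ) + 3) * coeff (n + 3) (sqrtSeries lam) =
      (2 * n + 3) * lam * coeff (n + 2) (sqrtSeries lam) +
        n * (2 - lam ^ 2) * coeff (n + 1) (sqrtSeries lam) := by
  have h := semicircleMoment_succ lam n
  rw [coeff_add_two_sqrtSeries lam (n + 1), coeff_add_two_sqrtSeries lam n]
  rcases n with _ | n
  · simp only [Nat.cast_zero, zero_mul] at h ⊢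
    linear_combination -h
  · rw [coeff_add_two_sqrtSeries]
    rw [Nat.add_sub_cancel] at h
    linear_combination -h

theorem sqrtSeries_ode (lam : ℝ) :
    ((1 - C lam * X) ^ 2 - C 2 * X ^ 2) * d⁄dX ℝ (sqrtSeries lam) =
      (C (lam ^ 2 - 2) * X - C lam) * sqrtSeries lam := by
  have h1 : ((1 - C lam * X) ^ 2 - C 2 * X ^ 2) * d⁄dX ℝ (sqrtSeries lam) =
      d⁄dX ℝ (sqrtSeries lam) - X * (C (2 * lam) * d⁄dX ℝ (sqrtSeries lam)) +
        X * (X * (C (lam ^ 2 - 2) * d⁄dX ℝ (sqrtSeries lam))) := by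
    simp only [map_sub, map_mul, map_pow, map_ofNat]
    ring
  have h2 : (C (lam ^ 2 - 2) * X - C lam) * sqrtSeries lam =
      X * (C (lam ^ 2 - 2) * sqrtSeries lam) - C lam * sqrtSeries lam := by
    ring
  rw [h1, h2]
  generalize he : lam ^ 2 - 2 = e
  ext n
  have hc0 : coeff 0 (sqrtSeries lam) = 1 := by
    rw [coeff_zero_eq_constantCoeff_apply, constantCoeff_sqrtSeries]
  have hc1 := coeff_one_sqrtSeries lam
  have hc2 := coeff_add_two_sqrtSeries lam 0
  rw [semicircleMoment_zero] at hc2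
  rcases n with _ | _ | n
  · simp only [map_add, map_sub, coeff_C_mul, coeff_derivative, zero_add, coeff_zero_X_mul,
      hc0, hc1]
    ring
  · simp only [map_add, map_sub, coeff_succ_X_mul, coeff_C_mul, coeff_derivative,
      zero_add, coeff_zero_X_mul, hc0, hc1, hc2, Nat.reduceAdd]
    push_cast
    linear_combination he
  · simp only [map_add, map_sub, coeff_succ_X_mul, coeff_C_mul, coeff_derivative]
    have h := coeff_add_three_sqrtSeries lam n
    push_cast
    linear_combination h + n * coeff (n + 1) (sqrtSeries lam) * (-he)

theorem sqrtSeries_sq (lam : ℝ) : sqrtSeries lam ^ 2 = (1 - C lam * X) ^ 2 - C 2 * X ^ 2 := by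
  have hode := sqrtSeries_ode lam
  have hd : d⁄dX ℝ ((1 - C lam * X) ^ 2 - C 2 * X ^ 2 : PowerSeries ℝ) =
      2 * (C (lam ^ 2 - 2) * X - C lam) := by
    simp only [map_sub, map_mul, sq, Derivation.leibniz, derivative_C, derivative_X,
      Derivation.map_one_eq_zero, smul_eq_mul]
    rw [map_ofNat]
    ring
  have hD0 : constantCoeff ((1 - C lam * X) ^ 2 - C 2 * X ^ 2 : PowerSeries ℝ) = 1 := by simp
  generalize ((1 - C lam * X) ^ 2 - C 2 * X ^ 2 : PowerSeries ℝ) = D at *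
  have hDi : D⁻¹ * D = 1 := PowerSeries.inv_mul_cancel _ (by simp [hD0])
  have hD : D ≠ 0 := fun h => by simp [h] at hD0
  have hQ : sqrtSeries lam ^ 2 = sqrtSeries lam ^ 2 * D⁻¹ * D := by rw [mul_assoc, hDi, mul_one]
  have hQ1 : sqrtSeries lam ^ 2 * D⁻¹ = 1 := by
    refine derivative.ext ?_ ?_
    · have h := congrArg (d⁄dX ℝ) hQ
      rw [sq, Derivation.leibniz, Derivation.leibniz, ← sq, smul_eq_mul, smul_eq_mul, smul_eq_mul,
        hd] at h
      rw [Derivation.map_one_eq_zero]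
      refine (mul_eq_zero.1 ?_).resolve_left (pow_ne_zero 2 hD)
      linear_combination (-D) * h + 2 * sqrtSeries lam * hode +
        (2 * (C (lam ^ 2 - 2) * X - C lam)) * hQ
    · simp [hD0, constantCoeff_sqrtSeries]
  rw [hQ, hQ1, one_mul]

theorem mk_moment_mul {lam : ℝ} (hlam : 0 < lam) :
    mk (fun n => ∫ x, x ^ n ∂(nuMeas lam)) * (sqrtSeries lam + C lam * X) = 1 := by
  have h : mk (fun n => ∫ x, x ^ n ∂(nuMeas lam)) * (1 - C (2 * lam) * X - C 2 * X ^ 2) =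
      sqrtSeries lam - C lam * X := by
    have h1 : ∀ M : PowerSeries ℝ, M * (1 - C (2 * lam) * X - C 2 * X ^ 2) =
        M - X * (C (2 * lam) * M) - X * (X * (C 2 * M)) := fun M => by ring
    rw [h1]
    ext n
    rcases n with _ | _ | n
    · simpa [constantCoeff_sqrtSeries] using moment_nuMeas_zero hlam
    · simp only [zero_add, map_sub, coeff_succ_X_mul, coeff_C_mul, coeff_mk, coeff_zero_X_mul,
        moment_nuMeas_zero hlam, moment_nuMeas_one hlam, coeff_one_sqrtSeries, coeff_one_X]
      ring
    · simp only [map_sub, coeff_succ_X_mul, coeff_C_mul, coeff_mk, coeff_add_two_sqrtSeries,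
        moment_nuMeas_add_two hlam, coeff_X]
      rw [if_neg (by omega)]
      ring
  have h0 : sqrtSeries lam - C lam * X ≠ 0 := fun h => by
    have := congrArg constantCoeff h
    simp [constantCoeff_sqrtSeries] at this
  refine mul_right_cancel₀ h0 ?_
  have h2 := sqrtSeries_sq lam
  simp only [map_mul, map_ofNat] at h h2
  linear_combination mk (fun n => ∫ x, x ^ n ∂(nuMeas lam)) * h2 + h

end Moments

theorem stmt14 (lam : ℝ) (hlam : 0 < lam) (n : ℕ) :
    Filter.Tendsto
      (fun m : ℕ => (m : ℝ) ^ (-(n : ℝ) / 2) * gM m n (lam * Real.sqrt m))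
      Filter.atTop (nhds (∫ x, x ^ n ∂(nuMeas lam))) := by
  have h := tendsto_gM (constantCoeff_sqrtSeries lam) (sqrtSeries_sq lam) (mk_moment_mul hlam) n
  rwa [PowerSeries.coeff_mk] at h
end

section
/- For every λ > 0, the measure ν_λ is a probability measure; explicitly, λ/√(λ² + 2) + ∫_{λ−√2}^{λ+√2} √(2 − (x − λ)²)/(π(λ² + 2 − (x − λ)²)) dx = 1. -/
open MeasureTheory

lemma semicircle_quotient_continuousOn {lam : ℝ} (hlam : 0 < lam) :
    ContinuousOn (fun y : ℝ => Real.sqrt (2 - y ^ 2) / (Real.pi * (lam ^ 2 + 2 - y ^ 2)))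
      (Set.Icc (-Real.sqrt 2) (Real.sqrt 2)) := by
  refine ContinuousOn.div (by fun_prop) (by fun_prop) fun y hy => ?_
  have h2 : y ^ 2 ≤ 2 := by
    have := Real.sq_sqrt (show (0 : ℝ) ≤ 2 by norm_num)
    nlinarith [hy.1, hy.2]
  have : 0 < lam ^ 2 + 2 - y ^ 2 := by nlinarith
  positivity

lemma hasDerivAt_semicircle_quotient_primitive {lam y : ℝ} (hlam : 0 < lam)
    (hy : y ^ 2 < 2) :
    HasDerivAt (fun y : ℝ => (Real.arcsin (y / Real.sqrt 2) - lam / Real.sqrt (lam ^ 2 + 2) *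
        Real.arcsin (lam * y / (Real.sqrt 2 * Real.sqrt (lam ^ 2 + 2 - y ^ 2)))) / Real.pi)
      (Real.sqrt (2 - y ^ 2) / (Real.pi * (lam ^ 2 + 2 - y ^ 2))) y := by
  have hwpos : 0 < lam ^ 2 + 2 - y ^ 2 := by nlinarith
  have hspos : 0 < 2 - y ^ 2 := by linarith
  have hcpos : 0 < lam ^ 2 + 2 := by positivity
  have hw := Real.sq_sqrt hwpos.le
  have hs := Real.sq_sqrt hspos.le
  have hc := Real.sq_sqrt hcpos.le
  have hr := Real.sq_sqrt (show (0 : ℝ) ≤ 2 by norm_num)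
  have hw0 := Real.sqrt_pos.2 hwpos
  have hs0 := Real.sqrt_pos.2 hspos
  have hc0 := Real.sqrt_pos.2 hcpos
  have hr0 := Real.sqrt_pos.2 (show (0 : ℝ) < 2 by norm_num)
  have hdw : HasDerivAt (fun y : ℝ => Real.sqrt (lam ^ 2 + 2 - y ^ 2))
      (-(2 * y) / (2 * Real.sqrt (lam ^ 2 + 2 - y ^ 2))) y := by
    have h : HasDerivAt (fun y : ℝ => lam ^ 2 + 2 - y ^ 2) (-(2 * y)) y := by
      simpa using (hasDerivAt_pow 2 y).const_sub (lam ^ 2 + 2)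
    exact h.sqrt hwpos.ne'
  set w := Real.sqrt (lam ^ 2 + 2 - y ^ 2) with hwdef
  set s := Real.sqrt (2 - y ^ 2) with hsdef
  set c := Real.sqrt (lam ^ 2 + 2) with hcdef
  set r := Real.sqrt 2 with hrdef
  have h1 : 1 - (y / r) ^ 2 = (s / r) ^ 2 := by
    field_simp
    linarith
  have h2 : 1 - (lam * y / (r * w)) ^ 2 = (c * s / (r * w)) ^ 2 := by
    field_simp
    rw [hw, hs, hc, hr]
    ring
  have ne_of_sq {u v : ℝ} (hv : 0 < v) (h : 1 - u ^ 2 = v ^ 2) : u ≠ -1 ∧ u ≠ 1 := by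
    constructor <;> rintro rfl <;> nlinarith [pow_pos hv 2]
  obtain ⟨h1a, h1b⟩ := ne_of_sq (by positivity) h1
  obtain ⟨h2a, h2b⟩ := ne_of_sq (by positivity) h2
  have d1 := (Real.hasDerivAt_arcsin h1a h1b).comp y ((hasDerivAt_id y).div_const r)
  have du : HasDerivAt (fun y : ℝ => lam * y / (r * Real.sqrt (lam ^ 2 + 2 - y ^ 2))) _ y :=
    ((hasDerivAt_id y).const_mul lam).div (hdw.const_mul r) (by positivity)
  have d2 := HasDerivAt.comp y (Real.hasDerivAt_arcsin h2a h2b) du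
  have d := (d1.sub (d2.const_mul (lam / c))).div_const Real.pi
  refine d.congr_deriv ?_
  rw [h1, h2, Real.sqrt_sq (by positivity), Real.sqrt_sq (by positivity), ← hwdef, ← hw]
  simp only [id]
  have hpi := Real.pi_pos
  field_simp
  have e1 : w ^ 2 = lam ^ 2 + s ^ 2 := by rw [hw, hs]; ring
  have e2 : y ^ 2 = 2 - s ^ 2 := by rw [hs]; ring
  rw [e2, e1, hc]
  ring

lemma integral_semicircle_quotient {lam : ℝ} (hlam : 0 < lam) :
    ∫ y in (-Real.sqrt 2)..(Real.sqrt 2),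
      Real.sqrt (2 - y ^ 2) / (Real.pi * (lam ^ 2 + 2 - y ^ 2)) =
    1 - lam / Real.sqrt (lam ^ 2 + 2) := by
  have hr0 : 0 < Real.sqrt 2 := by positivity
  have hr := Real.sq_sqrt (show (0 : ℝ) ≤ 2 by norm_num)
  have hle : -Real.sqrt 2 ≤ Real.sqrt 2 := by linarith
  rw [intervalIntegral.integral_eq_sub_of_hasDerivAt_of_le hle _
    (fun y hy => hasDerivAt_semicircle_quotient_primitive hlam
      (by nlinarith [hy.1, hy.2] : y ^ 2 < 2))
    ((semicircle_quotient_continuousOn hlam).intervalIntegrable_of_Icc hle)]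
  · have e : lam * Real.sqrt 2 / (Real.sqrt 2 * lam) = 1 := by field_simp
    have hpi := Real.pi_pos
    simp only [neg_sq, hr, add_sub_cancel_right, Real.sqrt_sq hlam.le, mul_neg, neg_div, e,
      div_self hr0.ne', Real.arcsin_neg, Real.arcsin_one]
    field_simp
    ring
  · refine ContinuousOn.div_const (ContinuousOn.sub ?_ (ContinuousOn.mul ?_ ?_)) _
    · fun_prop
    · fun_prop
    · refine Real.continuous_arcsin.comp_continuousOn
        (ContinuousOn.div (by fun_prop) (by fun_prop) fun y hy => ?_)
      have : 0 < lam ^ 2 + 2 - y ^ 2 := by nlinarith [hy.1, hy.2]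
      positivity

lemma nuAC_univ {lam : ℝ} (hlam : 0 < lam) :
    nuAC lam Set.univ = ENNReal.ofReal (∫ x in (lam - Real.sqrt 2)..(lam + Real.sqrt 2),
      Real.sqrt (2 - (x - lam) ^ 2) / (Real.pi * (lam ^ 2 + 2 - (x - lam) ^ 2))) := by
  classical
  have hr := Real.sq_sqrt (show (0 : ℝ) ≤ 2 by norm_num)
  have hr0 : 0 < Real.sqrt 2 := by positivity
  have hle : lam - Real.sqrt 2 ≤ lam + Real.sqrt 2 := by linarith
  have hcont : ContinuousOn (fun x : ℝ => Real.sqrt (2 - (x - lam) ^ 2) /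
      (Real.pi * (lam ^ 2 + 2 - (x - lam) ^ 2)))
      (Set.Icc (lam - Real.sqrt 2) (lam + Real.sqrt 2)) :=
    (semicircle_quotient_continuousOn hlam).comp (f := fun x : ℝ => x - lam) (by fun_prop)
      fun x hx => ⟨by linarith [hx.1], by linarith [hx.2]⟩
  rw [nuAC, withDensity_apply _ MeasurableSet.univ, Measure.restrict_univ,
    intervalIntegral.integral_of_le hle, integral_Ioc_eq_integral_Ioo,
    ofReal_integral_eq_lintegral_ofReal (hcont.integrableOn_Icc.mono_set Set.Ioo_subset_Icc_self),
    ← lintegral_indicator measurableSet_Ioo]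
  · refine lintegral_congr fun x => ?_
    by_cases hx : x ∈ Set.Ioo (lam - Real.sqrt 2) (lam + Real.sqrt 2)
    · rw [if_pos hx, Set.indicator_of_mem hx]
    · rw [if_neg hx, Set.indicator_of_notMem hx, ENNReal.ofReal_zero]
  · refine (ae_restrict_mem measurableSet_Ioo).mono fun x hx => ?_
    have : 0 ≤ lam ^ 2 + 2 - (x - lam) ^ 2 := by nlinarith [hx.1, hx.2]
    have hpi := Real.pi_pos
    exact div_nonneg (Real.sqrt_nonneg _) (by positivity)

theorem stmt16 (lam : ℝ) (hlam : 0 < lam) :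
    IsProbabilityMeasure (nuMeas lam) ∧
      lam / Real.sqrt (lam ^ 2 + 2) +
        (∫ x in (lam - Real.sqrt 2)..(lam + Real.sqrt 2),
          Real.sqrt (2 - (x - lam) ^ 2) / (Real.pi * (lam ^ 2 + 2 - (x - lam) ^ 2))) = 1 := by
  have hint : (∫ x in (lam - Real.sqrt 2)..(lam + Real.sqrt 2),
      Real.sqrt (2 - (x - lam) ^ 2) / (Real.pi * (lam ^ 2 + 2 - (x - lam) ^ 2))) =
      1 - lam / Real.sqrt (lam ^ 2 + 2) := by
    rw [← integral_semicircle_quotient hlam, intervalIntegral.integral_comp_sub_right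
      (fun y => Real.sqrt (2 - y ^ 2) / (Real.pi * (lam ^ 2 + 2 - y ^ 2)))]
    simp
  refine ⟨⟨?_⟩, by rw [hint]; ring⟩
  have h1 : lam / Real.sqrt (lam ^ 2 + 2) ≤ 1 := by
    rw [div_le_one (by positivity)]
    exact Real.le_sqrt_of_sq_le (by linarith)
  rw [nuMeas, Measure.add_apply, Measure.smul_apply, measure_univ, smul_eq_mul, mul_one,
    nuAC_univ hlam, hint, ← ENNReal.ofReal_add (by positivity) (by linarith)]
  simp
end

section
/- For every k ≥ 1, the number of pairs (π, L), where π is a noncrossing partition of {1, …, 2k} into k blocks of cardinality 2 and L : π → {1, …, k} is a bijection satisfying L(B) < L(B′) whenever min B < min B′ < max B′ < max B (i.e. L is strictly increasing along nested blocks), equals the double factorial (2k − 1)!! = 1·3·5⋯(2k − 1). -/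
open MeasureTheory

/-- A Stirling permutation of the multiset `{0, 0, 1, 1, …, k - 1, k - 1}`: between the two
occurrences of a letter there are only larger letters. -/
structure IsStirlingWord (k : ℕ) (l : List ℕ) : Prop where
  lt : ∀ x ∈ l, x < k
  count : ∀ x < k, l.count x = 2
  le : ∀ a b, [a, b, a].Sublist l → a ≤ b

theorem append_pair_inj {k : ℕ} {u v u' v' : List ℕ} (hu : k ∉ u) (hu' : k ∉ u')
    (h : u ++ k :: k :: v = u' ++ k :: k :: v') : u = u' ∧ v = v' := by
  induction u generalizing u' with
  | nil => cases u' <;> simp_all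
  | cons x u ih =>
    cases u' with
    | nil => simp_all
    | cons y u' =>
      simp only [List.cons_append, List.cons.injEq, List.mem_cons, not_or] at h hu hu' ⊢
      obtain ⟨h1, h2⟩ := ih hu.2 hu'.2 h.2
      exact ⟨⟨h.1, h1⟩, h2⟩

theorem isStirlingWord_succ_append {k : ℕ} {u v : List ℕ} (h : IsStirlingWord k (u ++ v)) :
    IsStirlingWord (k + 1) (u ++ k :: k :: v) := by
  have hk : ∀ x ∈ u ++ v, x ≠ k := fun x hx => (h.lt x hx).ne
  have hku : k ∉ u := fun hx => hk k (by simp [hx]) rfl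
  have hkv : k ∉ v := fun hx => hk k (by simp [hx]) rfl
  refine ⟨?_, ?_, ?_⟩
  · intro x hx
    have := h.lt x
    simp only [List.mem_append, List.mem_cons] at hx this
    grind
  · intro x hx
    rcases (Nat.lt_succ_iff_lt_or_eq.mp hx) with hx | rfl
    · have := h.count x hx
      simp only [List.count_append, List.count_cons] at this ⊢
      have : k ≠ x := hx.ne'
      simp [this]; omega
    · simp [List.count_append, List.count_eq_zero_of_not_mem hku,
        List.count_eq_zero_of_not_mem hkv]
  · intro a b hs
    by_contra! hba
    have ha : a < k + 1 := by
      have := hs.subset (show a ∈ [a, b, a] by simp)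
      have := h.lt a
      simp only [List.mem_append, List.mem_cons] at *
      grind
    have hf : (u ++ k :: k :: v).filter (· ≠ k) = u ++ v := by
      have := List.filter_eq_self (p := (· ≠ k)) |>.2 (fun x hx => by simpa using hk x hx)
      simpa using this
    rcases (Nat.lt_succ_iff_lt_or_eq.mp ha) with ha | rfl
    · have h2 := hs.filter (· ≠ k)
      rw [hf] at h2
      have : [a, b, a].filter (· ≠ k) = [a, b, a] := by
        rw [List.filter_eq_self]; simp; omega
      rw [this] at h2
      exact absurd (h.le a b h2) (by omega)
    · have h1 : [a, b, a].Sublist (a :: a :: v) := by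
        clear hf h hk
        induction u with
        | nil => simpa using hs
        | cons x u ih =>
          simp only [List.mem_cons, not_or] at hku
          refine ih hku.2 ?_
          rw [List.cons_append] at hs
          cases hs with
          | cons _ h => exact h
          | cons_cons => exact absurd rfl hku.1
      have h2 : [b, a].Sublist (a :: v) := by simpa using h1
      have h3 : [b, a].Sublist v := by
        cases h2 with
        | cons _ h => exact h
        | cons_cons => omega
      exact hkv (h3.subset (by simp))

theorem IsStirlingWord.exists_eq_append {k : ℕ} {l : List ℕ} (h : IsStirlingWord (k + 1) l) :
    ∃ u v, l = u ++ k :: k :: v ∧ IsStirlingWord k (u ++ v) := by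
  have hc := h.count k (by omega)
  obtain ⟨u, m, rfl, hu⟩ := List.eq_append_cons_of_mem
    (List.count_pos_iff.1 (by omega : 0 < l.count k))
  have hc' : m.count k = 1 := by
    simpa [List.count_append, List.count_eq_zero_of_not_mem hu] using hc
  obtain ⟨m, v, rfl, hm⟩ := List.eq_append_cons_of_mem
    (List.count_pos_iff.1 (by omega : 0 < m.count k))
  have hv : k ∉ v := by
    rw [← List.count_eq_zero]
    simpa [List.count_append, List.count_eq_zero_of_not_mem hm] using hc'
  have hm0 : m = [] := by
    rw [List.eq_nil_iff_forall_not_mem]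
    intro b hb
    have hs : [k, b, k].Sublist (u ++ k :: (m ++ k :: v)) := by
      refine List.Sublist.trans ?_ (List.sublist_append_right _ _)
      refine List.Sublist.cons_cons _ ?_
      exact List.Sublist.append (List.singleton_sublist.2 hb) (by simp)
    have h1 := h.le k b hs
    have h2 := h.lt b (by simp [hb])
    obtain rfl : b = k := by omega
    exact hm hb
  subst hm0
  refine ⟨u, v, rfl, ?_, ?_, ?_⟩
  · intro x hx
    have h1 := h.lt x (by simp at hx ⊢; tauto)
    have : x ≠ k := by rintro rfl; simp at hx; tauto
    omega
  · intro x hx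
    have := h.count x (by omega)
    have hne : k ≠ x := hx.ne'
    simpa [List.count_append, hne] using this
  · intro a b hs
    refine h.le a b (hs.trans (List.Sublist.append_left ?_ _))
    simp

theorem IsStirlingWord.length_eq {k : ℕ} {l : List ℕ} (h : IsStirlingWord k l) :
    l.length = 2 * k := by
  induction k generalizing l with
  | zero =>
    have : l = [] := List.eq_nil_iff_forall_not_mem.2 fun x hx => by simpa using h.lt x hx
    simp [this]
  | succ k ih =>
    obtain ⟨u, v, rfl, h'⟩ := h.exists_eq_append
    have := ih h'
    simp at this ⊢
    omega

theorem IsStirlingWord.notMem {k : ℕ} {l : List ℕ} (h : IsStirlingWord k l) : k ∉ l :=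
  fun hx => (h.lt k hx).false

theorem card_isStirlingWord_succ (k : ℕ) :
    Nat.card {l // IsStirlingWord (k + 1) l} =
      Nat.card {l // IsStirlingWord k l} * (2 * k + 1) := by
  rw [← Nat.card_fin (2 * k + 1), ← Nat.card_prod]
  symm
  refine Nat.card_congr (Equiv.ofBijective
    (fun p => ⟨p.1.1.take p.2 ++ k :: k :: p.1.1.drop p.2,
      isStirlingWord_succ_append (by simpa using p.1.2)⟩) ⟨?_, ?_⟩)
  · rintro ⟨⟨l, hl⟩, i⟩ ⟨⟨l', hl'⟩, i'⟩ h
    simp only [Subtype.mk.injEq] at h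
    obtain ⟨h1, h2⟩ := append_pair_inj (fun hx => hl.notMem (List.mem_of_mem_take hx))
      (fun hx => hl'.notMem (List.mem_of_mem_take hx)) h
    have hll : l = l' := by rw [← List.take_append_drop i l, h1, h2, List.take_append_drop]
    have := congrArg List.length h1
    have := hl.length_eq
    have := hl'.length_eq
    simp only [List.length_take] at *
    simp only [Prod.mk.injEq, Subtype.mk.injEq, Fin.ext_iff]
    refine ⟨hll, by omega⟩
  · rintro ⟨l, hl⟩
    obtain ⟨u, v, rfl, h⟩ := hl.exists_eq_append
    have := h.length_eq
    simp only [List.length_append] at this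
    exact ⟨(⟨u ++ v, h⟩, ⟨u.length, by omega⟩), by simp⟩

theorem card_isStirlingWord (k : ℕ) :
    Nat.card {l // IsStirlingWord k l} = Nat.doubleFactorial (2 * k - 1) := by
  induction k with
  | zero =>
    have : Unique {l // IsStirlingWord 0 l} :=
      { default := ⟨[], by simp, by simp, by simp⟩
        uniq := fun l => Subtype.ext (List.eq_nil_of_length_eq_zero l.2.length_eq) }
    simp
  | succ k ih =>
    rw [card_isStirlingWord_succ, ih]
    cases k with
    | zero => simp
    | succ k =>
      rw [show 2 * (k + 1 + 1) - 1 = (2 * k + 1) + 2 by omega, Nat.doubleFactorial_add_two,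
        show 2 * (k + 1) - 1 = 2 * k + 1 by omega]
      ring

/-- A Stirling permutation as a function on positions. -/
def IsStirlingFun {n k : ℕ} (w : Fin n → Fin k) : Prop :=
  (∀ c, (Finset.univ.filter fun i => w i = c).card = 2) ∧
    ∀ i j m, i < j → j < m → w i = w m → w i ≤ w j

theorem isStirlingWord_ofFn_iff {n k : ℕ} (w : Fin n → Fin k) :
    IsStirlingWord k (List.ofFn fun i => (w i : ℕ)) ↔ IsStirlingFun w := by
  have hcount (c : Fin k) : (List.ofFn fun i => (w i : ℕ)).count (c : ℕ) =
      (Finset.univ.filter fun i => w i = c).card := by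
    rw [List.ofFn_eq_map, List.count, List.countP_map, List.countP_eq_length_filter,
      ← List.toFinset_card_of_nodup ((List.nodup_finRange n).filter _)]
    congr 1
    ext i
    simp [Fin.ext_iff]
  constructor
  · rintro ⟨-, h2, h3⟩
    refine ⟨fun c => hcount c ▸ h2 c c.2, fun i j m hij hjm him => h3 (w i) (w j) ?_⟩
    rw [List.ofFn_eq_map, show [(w i : ℕ), w j, w i] = [i, j, m].map (fun i => (w i : ℕ)) by
      simp [him]]
    refine List.Sublist.map _ (List.sublist_of_subperm_of_pairwise (r := (· < ·)) ?_ ?_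
      (List.pairwise_lt_finRange n))
    · refine List.subperm_of_subset ?_ fun x _ => List.mem_finRange x
      simp [hij.ne, hjm.ne, (hij.trans hjm).ne]
    · simp [hij, hjm, hij.trans hjm]
  · rintro ⟨h1, h2⟩
    refine ⟨by simp, fun x hx => (hcount ⟨x, hx⟩).trans (h1 _), fun a b hs => ?_⟩
    rw [List.ofFn_eq_map, List.sublist_map_iff] at hs
    obtain ⟨l, hl, h⟩ := hs
    obtain ⟨i, j, m, rfl⟩ := List.length_eq_three.1
      (show l.length = 3 by simpa using (congrArg List.length h).symm)
    simp only [List.map_cons, List.map_nil, List.cons.injEq, and_true] at h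
    obtain ⟨rfl, rfl, h⟩ := h
    have := (List.pairwise_lt_finRange n).sublist hl
    simp only [List.pairwise_cons, List.mem_cons, forall_eq_or_imp] at this
    exact h2 i j m this.1.1 this.2.1.1 (Fin.ext h)

theorem card_isStirlingFun (k : ℕ) :
    Nat.card {w : Fin (2 * k) → Fin k // IsStirlingFun w} = Nat.doubleFactorial (2 * k - 1) := by
  rw [← card_isStirlingWord]
  refine Nat.card_congr (Equiv.ofBijective
    (fun w => ⟨List.ofFn fun i => (w.1 i : ℕ), (isStirlingWord_ofFn_iff w.1).2 w.2⟩) ⟨?_, ?_⟩)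
  · rintro ⟨w, hw⟩ ⟨w', hw'⟩ h
    simp only [Subtype.mk.injEq, List.ofFn_inj] at h
    exact Subtype.ext (funext fun i => Fin.ext (congrFun h i))
  · rintro ⟨l, hl⟩
    have hlen := hl.length_eq
    let w : Fin (2 * k) → Fin k := fun i => ⟨l[i], hl.lt _ (List.getElem_mem _)⟩
    have hw : (List.ofFn fun i => (w i : ℕ)) = l :=
      List.ext_getElem (by simp [hlen]) (by simp [w])
    exact ⟨⟨w, (isStirlingWord_ofFn_iff w).1 (hw ▸ hl)⟩, Subtype.ext hw⟩

/-- The block of positions carrying the letter `c`. -/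
def letterBlock {n k : ℕ} (w : Fin n → Fin k) (c : Fin k) : Finset (Fin n) :=
  Finset.univ.filter fun i => w i = c

/-- The partition of the positions by letters. -/
def letterPartition {n k : ℕ} (w : Fin n → Fin k) : Finset (Finset (Fin n)) :=
  Finset.univ.image (letterBlock w)

/-- `L` is an increasing labelling of the noncrossing pair partition `π`. -/
def IsIncreasingPairing {n k : ℕ} (π : Finset (Finset (Fin n))) (L : {B // B ∈ π} → Fin k) :
    Prop :=
  IsSetPartition π ∧ NonCrossing π ∧ (∀ B ∈ π, B.card = 2) ∧
    π.card = k ∧ Function.Bijective L ∧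
    (∀ B B' : {B // B ∈ π}, NestedLT B.val B'.val → L B < L B')

theorem IsIncreasingPairing.exists_isStirlingFun {n k : ℕ} {π : Finset (Finset (Fin n))}
    {L : {B // B ∈ π} → Fin k} (h : IsIncreasingPairing π L) :
    ∃ w : Fin n → Fin k, IsStirlingFun w ∧ ∀ B : {B // B ∈ π}, ∀ i ∈ B.1, w i = L B := by
  obtain ⟨⟨-, hcov, hdisj⟩, hnc, hcard, -, hbij, hmono⟩ := h
  choose b hb hib using hcov
  have huniq (B : {B // B ∈ π}) (i) (hi : i ∈ B.1) : B = ⟨b i, hb i⟩ := by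
    by_contra hne
    exact Finset.disjoint_left.1 (hdisj _ B.2 _ (hb i) fun h => hne (Subtype.ext h)) hi (hib i)
  refine ⟨fun i => L ⟨b i, hb i⟩, ⟨fun c => ?_, fun i j m hij hjm him => ?_⟩,
    fun B i hi => by rw [huniq B i hi]⟩
  · obtain ⟨B, rfl⟩ := hbij.2 c
    rw [← hcard _ B.2]
    congr 1
    ext i
    simp only [Finset.mem_filter, Finset.mem_univ, true_and, hbij.1.eq_iff]
    exact ⟨fun h => h ▸ hib i, fun hi => (huniq B i hi).symm⟩
  · have him' : b i = b m := congrArg Subtype.val (hbij.1 him)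
    by_cases hbij' : b i = b j
    · simp [hbij']
    have hm : m ∈ b i := him' ▸ hib m
    refine (hmono _ _ ⟨i, hib i, m, hm, fun x hx => ⟨?_, ?_⟩⟩).le
    · by_contra! hxi
      rcases hxi.lt_or_eq with hxi | rfl
      · exact hnc _ (hb j) _ (hb i) (Ne.symm hbij') x hx j (hib j) i (hib i) m hm ⟨hxi, hij, hjm⟩
      · exact Finset.disjoint_left.1 (hdisj _ (hb x) _ (hb j) hbij') (hib x) hx
    · by_contra! hmx
      rcases hmx.lt_or_eq with hmx | rfl
      · exact hnc _ (hb i) _ (hb j) hbij' i (hib i) m hm j (hib j) x hx ⟨hij, hjm, hmx⟩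
      · exact Finset.disjoint_left.1 (hdisj _ (hb i) _ (hb j) hbij') hm hx

theorem IsStirlingFun.letterBlock_nonempty {n k : ℕ} {w : Fin n → Fin k} (hw : IsStirlingFun w)
    (c : Fin k) : (letterBlock w c).Nonempty :=
  Finset.card_pos.1 (by rw [letterBlock, hw.1 c]; norm_num)

theorem mem_letterBlock {n k : ℕ} {w : Fin n → Fin k} {c : Fin k} {i : Fin n} :
    i ∈ letterBlock w c ↔ w i = c := by
  simp [letterBlock]

theorem IsStirlingFun.letterBlock_injective {n k : ℕ} {w : Fin n → Fin k}
    (hw : IsStirlingFun w) : Function.Injective (letterBlock w) := by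
  intro c d h
  obtain ⟨i, hi⟩ := hw.letterBlock_nonempty c
  exact (mem_letterBlock.1 hi).symm.trans (mem_letterBlock.1 (h ▸ hi))

theorem IsStirlingFun.exists_isIncreasingPairing {n k : ℕ} {w : Fin n → Fin k}
    (hw : IsStirlingFun w) :
    ∃ L : {B // B ∈ letterPartition w} → Fin k,
      IsIncreasingPairing (letterPartition w) L ∧ ∀ B, letterBlock w (L B) = B.1 := by
  have hmem (c) : letterBlock w c ∈ letterPartition w :=
    Finset.mem_image_of_mem _ (Finset.mem_univ c)
  have hex (B : {B // B ∈ letterPartition w}) : ∃ c, letterBlock w c = B.1 := by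
    simpa [letterPartition] using B.2
  choose L hL using hex
  have hforall {P : Finset (Fin n) → Prop} (h : ∀ c, P (letterBlock w c)) :
      ∀ B ∈ letterPartition w, P B := by simpa [letterPartition] using h
  refine ⟨L, ⟨⟨hforall hw.letterBlock_nonempty, fun i => ⟨_, hmem (w i), mem_letterBlock.2 rfl⟩,
    hforall fun c => hforall fun d hcd => ?_⟩, hforall fun c => hforall fun d hcd => ?_,
    hforall hw.1, ?_, ⟨fun B B' h => ?_, fun c => ⟨⟨_, hmem c⟩, ?_⟩⟩, fun B B' h => ?_⟩, hL⟩
  · refine Finset.disjoint_left.2 fun i hi hi' => hcd ?_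
    rw [← mem_letterBlock.1 hi, ← mem_letterBlock.1 hi']
  · rintro v₁ hv₁ v₂ hv₂ w₁ hw₁ w₂ hw₂ ⟨h1, h2, h3⟩
    rw [mem_letterBlock] at hv₁ hv₂ hw₁ hw₂
    have h4 := hw.2 _ _ _ h1 h2 (hv₁.trans hv₂.symm)
    have h5 := hw.2 _ _ _ h2 h3 (hw₁.trans hw₂.symm)
    rw [hv₁, hw₁] at h4
    rw [hv₂, hw₁] at h5
    exact hcd (by rw [le_antisymm h4 h5])
  · rw [letterPartition, Finset.card_image_of_injective _ hw.letterBlock_injective,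
      Finset.card_univ, Fintype.card_fin]
  · exact Subtype.ext (by rw [← hL B, ← hL B', h])
  · exact hw.letterBlock_injective (hL _)
  · obtain ⟨lo, hlo, hi, hhi, h⟩ := h
    obtain ⟨x, hx⟩ := hw.letterBlock_nonempty (L B')
    obtain ⟨h1, h2⟩ := h x (hL B' ▸ hx)
    have hwlo := mem_letterBlock.1 ((hL B).symm ▸ hlo)
    have hwhi := mem_letterBlock.1 ((hL B).symm ▸ hhi)
    have hle := hw.2 _ _ _ h1 h2 (hwlo.trans hwhi.symm)
    rw [hwlo, mem_letterBlock.1 hx] at hle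
    refine hle.lt_of_ne fun heq => ?_
    have hBB : B.1 = B'.1 := by rw [← hL B, ← hL B', heq]
    exact (h lo (hBB ▸ hlo)).1.false

theorem IsIncreasingPairing.eq_letterPartition {n k : ℕ} {π : Finset (Finset (Fin n))}
    {L : {B // B ∈ π} → Fin k} (h : IsIncreasingPairing π L) {w : Fin n → Fin k}
    (hw : ∀ B : {B // B ∈ π}, ∀ i ∈ B.1, w i = L B) : π = letterPartition w := by
  obtain ⟨⟨-, hcov, -⟩, -, -, -, hbij, -⟩ := h
  have hB (B : {B // B ∈ π}) : letterBlock w (L B) = B.1 := by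
    ext i
    rw [mem_letterBlock]
    refine ⟨fun hi => ?_, hw B i⟩
    obtain ⟨B', hB', hi'⟩ := hcov i
    rw [hw ⟨B', hB'⟩ i hi'] at hi
    rwa [← hbij.1 hi]
  ext B
  simp only [letterPartition, Finset.mem_image, Finset.mem_univ, true_and]
  refine ⟨fun h => ⟨_, hB ⟨B, h⟩⟩, ?_⟩
  rintro ⟨c, rfl⟩
  obtain ⟨B, rfl⟩ := hbij.2 c
  exact (hB B).symm ▸ B.2

theorem card_isIncreasingPairing (n k : ℕ) :
    Nat.card {p : Σ π : Finset (Finset (Fin n)), {B // B ∈ π} → Fin k //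
      IsIncreasingPairing p.1 p.2} = Nat.card {w : Fin n → Fin k // IsStirlingFun w} := by
  have hex (p : {p : Σ π : Finset (Finset (Fin n)), {B // B ∈ π} → Fin k //
    IsIncreasingPairing p.1 p.2}) := p.2.exists_isStirlingFun
  choose f hf hfL using hex
  refine Nat.card_congr (Equiv.ofBijective (fun p => ⟨f p, hf p⟩) ⟨?_, ?_⟩)
  · intro p p' h
    have hff : f p = f p' := congrArg Subtype.val h
    have hp := hfL p
    have hp' := hfL p'
    rw [← hff] at hp'
    generalize f p = w at hp hp'
    obtain ⟨⟨π, L⟩, hL⟩ := p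
    obtain ⟨⟨π', L'⟩, hL'⟩ := p'
    obtain rfl : π = π' := (hL.eq_letterPartition hp).trans (hL'.eq_letterPartition hp').symm
    obtain rfl : L = L' := by
      funext B
      obtain ⟨i, hi⟩ := hL.1.1 _ B.2
      exact (hp B i hi).symm.trans (hp' B i hi)
    rfl
  · rintro ⟨w, hw⟩
    obtain ⟨L, hL, hLB⟩ := hw.exists_isIncreasingPairing
    refine ⟨⟨⟨_, L⟩, hL⟩, Subtype.ext (funext fun i => ?_)⟩
    obtain ⟨B, hB, hi⟩ := hL.1.2.1 i
    refine (hfL ⟨⟨_, L⟩, hL⟩ ⟨B, hB⟩ i hi).trans ?_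
    exact (mem_letterBlock.1 ((hLB ⟨B, hB⟩).symm ▸ hi)).symm

theorem stmt18 (k : ℕ) (hk : 1 ≤ k) :
    Nat.card
      {p : Σ π : Finset (Finset (Fin (2 * k))), {B // B ∈ π} → Fin k //
        IsSetPartition p.1 ∧ NonCrossing p.1 ∧ (∀ B ∈ p.1, B.card = 2) ∧
          p.1.card = k ∧ Function.Bijective p.2 ∧
          (∀ B B' : {B // B ∈ p.1}, NestedLT B.val B'.val → p.2 B < p.2 B')}
      = Nat.doubleFactorial (2 * k - 1) := by
  exact (card_isIncreasingPairing (2 * k) k).trans (card_isStirlingFun k)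
end

section
/- For every λ > 0, let ρ_λ be the two-point probability measure ρ_λ = (1/2 − λ/(2√(λ² + 4)))·δ_{(λ+√(λ²+4))/2} + (1/2 + λ/(2√(λ² + 4)))·δ_{(λ−√(λ²+4))/2} on ℝ. Then for every natural number n, the (0,0) entry of the n-th power of the real 2×2 matrix [[0, 1], [1, λ]] equals the n-th moment of ρ_λ: (([[0,1],[1,λ]])^n)_{0,0} = ∫_ℝ x^n dρ_λ(x). -/
open MeasureTheory

-- The two-point law `ρ_λ`.
noncomputable def rhoMeas (lam : ℝ) : Measure ℝ :=
  (ENNReal.ofReal (1 / 2 - lam / (2 * Real.sqrt (lam ^ 2 + 4)))) •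
      Measure.dirac ((lam + Real.sqrt (lam ^ 2 + 4)) / 2) +
    (ENNReal.ofReal (1 / 2 + lam / (2 * Real.sqrt (lam ^ 2 + 4)))) •
      Measure.dirac ((lam - Real.sqrt (lam ^ 2 + 4)) / 2)

/-- A weighted power sum `p * a ^ n + q * b ^ n` over the two roots of `x ^ 2 = 1 + lam * x`, with
total mass one and mean zero, computes the vacuum moments of `!![0, 1; 1, lam]`. -/
theorem jacobi_pow_apply_zero {lam a b p q : ℝ} (ha : a ^ 2 = 1 + lam * a)
    (hb : b ^ 2 = 1 + lam * b) (hmass : p + q = 1) (hmean : p * a + q * b = 0) (n : ℕ) :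
    ((!![0, 1; 1, lam] : Matrix (Fin 2) (Fin 2) ℝ) ^ n) 0 0 = p * a ^ n + q * b ^ n ∧
      ((!![0, 1; 1, lam] : Matrix (Fin 2) (Fin 2) ℝ) ^ n) 0 1 =
        p * a ^ (n + 1) + q * b ^ (n + 1) := by
  induction n with
  | zero => simp [hmass, hmean]
  | succ n ih =>
    obtain ⟨h0, h1⟩ := ih
    rw [pow_succ, Matrix.mul_apply, Matrix.mul_apply, Fin.sum_univ_two, Fin.sum_univ_two, h0, h1]
    constructor
    · simp
    · simp only [Matrix.of_apply, Matrix.cons_val', Matrix.cons_val_zero, Matrix.cons_val_one,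
        Matrix.cons_val_fin_one]
      linear_combination (-p * a ^ n) * ha - q * b ^ n * hb

/-- Integration against a two-point measure with nonnegative weights. -/
theorem integral_two_point {p q : ℝ} (hp : 0 ≤ p) (hq : 0 ≤ q) (a b : ℝ) (f : ℝ → ℝ) :
    ∫ x, f x ∂(ENNReal.ofReal p • Measure.dirac a + ENNReal.ofReal q • Measure.dirac b) =
      p * f a + q * f b := by
  have hint (c r : ℝ) : Integrable f (ENNReal.ofReal r • Measure.dirac c) :=
    (integrable_dirac (by simp)).smul_measure ENNReal.ofReal_ne_top
  rw [integral_add_measure (hint a p) (hint b q), integral_smul_measure, integral_smul_measure,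
    integral_dirac, integral_dirac, ENNReal.toReal_ofReal hp, ENNReal.toReal_ofReal hq,
    smul_eq_mul, smul_eq_mul]

theorem stmt19 (lam : ℝ) (hlam : 0 < lam) (n : ℕ) :
    ((!![0, 1; 1, lam] : Matrix (Fin 2) (Fin 2) ℝ) ^ n) 0 0 =
      ∫ x, x ^ n ∂(rhoMeas lam) := by
  have hsq : Real.sqrt (lam ^ 2 + 4) ^ 2 = lam ^ 2 + 4 := Real.sq_sqrt (by positivity)
  have hpos : 0 < Real.sqrt (lam ^ 2 + 4) := Real.sqrt_pos.2 (by positivity)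
  have hle : lam ≤ Real.sqrt (lam ^ 2 + 4) := Real.le_sqrt_of_sq_le (by linarith)
  rw [rhoMeas]
  generalize Real.sqrt (lam ^ 2 + 4) = s at *
  have hweight : lam / (2 * s) ≤ 1 / 2 := by
    rw [div_le_div_iff₀ (by positivity) two_pos]
    linarith
  have hp : 0 ≤ 1 / 2 - lam / (2 * s) := sub_nonneg.2 hweight
  have hq : 0 ≤ 1 / 2 + lam / (2 * s) := by positivity
  rw [integral_two_point hp hq]
  refine (jacobi_pow_apply_zero ?_ ?_ ?_ ?_ n).1
  · linear_combination hsq / 4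
  · linear_combination hsq / 4
  · ring
  · field_simp
    ring
end
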